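/- arXiv:1703.06131 — 3 statements merged into one kernel-verified Lean document; each statement's English description precedes it below -/
import Mathlib

section
/- With the same state-space setup: fix n ≥ 1, k ≥ 0, measurable p₀ : ℝⁿ → [0,∞), q_i : ℝⁿ × ℝⁿ → [0,∞) (0 ≤ i ≤ k), g_i : ℝⁿ → [0,∞) (0 ≤ i ≤ k+1); potentials f₀(z,z') = p₀(z) q₀(z,z') g₀(z) g₁(z'), f_i(z,z') = q_i(z,z') g_{i+1}(z') for 1 ≤ i ≤ k; ρ(z₀,…,z_{k+1}) = ∏_{i=0}^{k} f_i(z_i, z_{i+1}) strictly positive with 0 < ∫ρ < ∞; reference probability measures η₀,…,η_{k+1} on ℝⁿ absolutely continuous with strictly positive densities e_i; and measurable block upper triangular maps M_i(x,y) = (M_i⁰(x,y), M_i¹(y)) satisfying c₀ := ∫ f₀, Measure.map M₀ (η₀.prod η₁) = measure with density f₀/c₀, and for 1 ≤ i ≤ k, c_i := ∫∫ e_i(x) f_i(M_{i-1}¹(x), y) dx dy ∈ (0,∞) and Measure.map M_i (η_i.prod η_{i+1}) = measure with density (x,y) ↦ e_i(x) f_i(M_{i-1}¹(x), y)/c_i.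 Then the product of the normalizing constants equals the model evidence: ∏_{i=0}^{k} c_i = ∫ ρ, i.e., the marginal likelihood π_{Y_{0:k+1}}(y_{0:k+1}). -/
open MeasureTheory ProbabilityTheory

/-- The pairwise potentials of the smoothing density of a state-space model:
`f₀(z,z') = p₀(z) q₀(z,z') g₀(z) g₁(z')` and `f_i(z,z') = q_i(z,z') g_{i+1}(z')` for `i ≥ 1`. -/
noncomputable def potential {n : ℕ} (p₀ : (Fin n → ℝ) → ℝ)
    (q : ℕ → (Fin n → ℝ) → (Fin n → ℝ) → ℝ) (g : ℕ → (Fin n → ℝ) → ℝ) :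
    ℕ → (Fin n → ℝ) → (Fin n → ℝ) → ℝ
  | 0 => fun z z' => p₀ z * q 0 z z' * g 0 z * g 1 z'
  | (i + 1) => fun z z' => q (i + 1) z z' * g (i + 2) z'

/-- The unnormalized smoothing density `ρ(z₀,…,z_{k+1}) = ∏_{i=0}^{k} f_i(z_i, z_{i+1})`. -/
noncomputable def smoothingDensity {n k : ℕ} (p₀ : (Fin n → ℝ) → ℝ)
    (q : ℕ → (Fin n → ℝ) → (Fin n → ℝ) → ℝ) (g : ℕ → (Fin n → ℝ) → ℝ)
    (z : Fin (k + 2) → Fin n → ℝ) : ℝ :=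
  ∏ i : Fin (k + 1), potential p₀ q g i (z i.castSucc) (z i.succ)


theorem aux_step {X : Type*} [MeasureSpace X] (ν ν' : Measure X)
    [IsProbabilityMeasure ν] [IsProbabilityMeasure ν']
    (m0 : X × X → X) (m1 : X → X) (hm0 : Measurable m0) (hm1 : Measurable m1)
    (D : X × X → ℝ) (hD : Measurable D) (c : ℝ) (hc : 0 < c)
    (hmap : Measure.map (fun p : X × X => (m0 p, m1 p.2)) (ν.prod ν') =
      (volume : Measure (X × X)).withDensity (fun p => ENNReal.ofReal (D p / c)))
    (h : X → ENNReal) (hh : Measurable h) :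
    ENNReal.ofReal c * ∫⁻ y, h (m1 y) ∂ν' = ∫⁻ p : X × X, ENNReal.ofReal (D p) * h p.2 := by
  have h1 : ∫⁻ p, h p.2 ∂(Measure.map (fun p : X × X => (m0 p, m1 p.2)) (ν.prod ν'))
      = ∫⁻ y, h (m1 y) ∂ν' := by
    rw [lintegral_map (by fun_prop) (by fun_prop)]
    rw [← (measurePreserving_snd (μ := ν) (ν := ν')).lintegral_comp
      (f := fun y => h (m1 y)) (by fun_prop)]
  rw [← h1, hmap, lintegral_withDensity_eq_lintegral_mul _ (by fun_prop) (by fun_prop),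
    ← lintegral_const_mul _ (by fun_prop)]
  refine lintegral_congr fun p => ?_
  simp only [Pi.mul_apply]
  rw [← mul_assoc, ← ENNReal.ofReal_mul hc.le, mul_div_cancel₀ _ hc.ne']

theorem aux_measurable {n k : ℕ} (p₀ : (Fin n → ℝ) → ℝ)
    (q : ℕ → (Fin n → ℝ) → (Fin n → ℝ) → ℝ)
    (g : ℕ → (Fin n → ℝ) → ℝ)
    (hp₀ : Measurable p₀)
    (hq : ∀ i ≤ k, Measurable (Function.uncurry (q i)))
    (hg : ∀ i ≤ k + 1, Measurable (g i)) (i : ℕ) (hi : i ≤ k) :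
    Measurable (fun p : (Fin n → ℝ) × (Fin n → ℝ) => potential p₀ q g i p.1 p.2) := by
  cases i with
  | zero =>
    have a := hq 0 hi
    have b := hg 0 (by omega)
    have d := hg 1 (by omega)
    simp only [potential]
    unfold Function.uncurry at a
    fun_prop
  | succ i =>
    have a := hq _ hi
    have d := hg (i + 2) (by omega)
    simp only [potential]
    unfold Function.uncurry at a
    fun_prop

theorem aux_nonneg {n k : ℕ} (p₀ : (Fin n → ℝ) → ℝ)
    (q : ℕ → (Fin n → ℝ) → (Fin n → ℝ) → ℝ)
    (g : ℕ → (Fin n → ℝ) → ℝ)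
    (hp₀pos : ∀ z, 0 ≤ p₀ z)
    (hqpos : ∀ i ≤ k, ∀ z z', 0 ≤ q i z z')
    (hgpos : ∀ i ≤ k + 1, ∀ z, 0 ≤ g i z) (i : ℕ) (hi : i ≤ k) (z z' : Fin n → ℝ) :
    0 ≤ potential p₀ q g i z z' := by
  cases i with
  | zero =>
    exact mul_nonneg (mul_nonneg (mul_nonneg (hp₀pos _) (hqpos _ hi _ _))
      (hgpos _ (by omega) _)) (hgpos _ (by omega) _)
  | succ i =>
    exact mul_nonneg (hqpos _ hi _ _) (hgpos _ (by omega) _)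

theorem aux_meas_prod {X : Type*} [MeasurableSpace X] (F : ℕ → X → X → ENNReal) (j : ℕ)
    (hF : ∀ i ≤ j, Measurable (fun p : X × X => F i p.1 p.2)) :
    Measurable (fun z : Fin (j + 2) → X =>
      ∏ i : Fin (j + 1), F i (z i.castSucc) (z i.succ)) := by
  refine Finset.measurable_prod _ fun i _ => ?_
  have hm : Measurable (fun z : Fin (j + 2) → X => (z i.castSucc, z i.succ)) :=
    (measurable_pi_apply _).prodMk (measurable_pi_apply _)
  exact (hF i (by omega)).comp hm

theorem aux_split {X : Type*} [MeasureSpace X] [SigmaFinite (volume : Measure X)]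
    (F : ℕ → X → X → ENNReal) (j : ℕ)
    (hF : ∀ i ≤ j + 1, Measurable (fun p : X × X => F i p.1 p.2))
    (h : X → ENNReal) (hh : Measurable h) :
    ∫⁻ z : Fin (j + 3) → X, (∏ i : Fin (j + 2), F i (z i.castSucc) (z i.succ)) *
        h (z (Fin.last _)) =
    ∫⁻ z : Fin (j + 2) → X, (∏ i : Fin (j + 1), F i (z i.castSucc) (z i.succ)) *
        ∫⁻ y, F (j + 1) (z (Fin.last _)) y * h y := by
  have hP := aux_meas_prod F j (fun i hi => hF i (by omega))
  have hL := hF (j + 1) le_rfl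
  have e := (volume_preserving_piFinSuccAbove (fun _ : Fin (j + 3) => X) (Fin.last _)).symm
  rw [← e.lintegral_comp_emb (MeasurableEquiv.measurableEmbedding _)]
  have hG : Measurable (fun p : X × (Fin (j + 2) → X) =>
      (∏ i : Fin (j + 1), F i (p.2 i.castSucc) (p.2 i.succ)) *
        (F (j + 1) (p.2 (Fin.last _)) p.1 * h p.1)) := by
    refine (hP.comp measurable_snd).mul (Measurable.mul ?_ (hh.comp measurable_fst))
    have hm : Measurable (fun p : X × (Fin (j + 2) → X) => (p.2 (Fin.last (j + 1)), p.1)) :=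
      ((measurable_pi_apply _).comp measurable_snd).prodMk measurable_fst
    exact hL.comp hm
  have key : ∀ p : X × (Fin (j + 2) → X),
      (∏ i : Fin (j + 2), F i
        ((MeasurableEquiv.piFinSuccAbove (fun _ : Fin (j + 3) => X) (Fin.last _)).symm p
          i.castSucc)
        ((MeasurableEquiv.piFinSuccAbove (fun _ : Fin (j + 3) => X) (Fin.last _)).symm p
          i.succ)) *
        h ((MeasurableEquiv.piFinSuccAbove (fun _ : Fin (j + 3) => X) (Fin.last _)).symm p
          (Fin.last _)) =
      (∏ i : Fin (j + 1), F i (p.2 i.castSucc) (p.2 i.succ)) *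
        (F (j + 1) (p.2 (Fin.last _)) p.1 * h p.1) := by
    intro p
    have hc : ∀ i : Fin (j + 2),
        (MeasurableEquiv.piFinSuccAbove (fun _ : Fin (j + 3) => X) (Fin.last _)).symm p
          i.castSucc = p.2 i := by
      intro i
      have := Fin.insertNth_apply_succAbove (α := fun _ : Fin (j + 3) => X)
        (Fin.last (j + 2)) p.1 p.2 i
      rw [Fin.succAbove_last] at this
      exact this
    have hl : (MeasurableEquiv.piFinSuccAbove (fun _ : Fin (j + 3) => X) (Fin.last _)).symm p
          (Fin.last _) = p.1 :=
      Fin.insertNth_apply_same (α := fun _ : Fin (j + 3) => X) (Fin.last (j + 2)) p.1 p.2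
    rw [Fin.prod_univ_castSucc, mul_assoc]
    simp only [hc, Fin.succ_last, hl, Fin.val_castSucc, Fin.val_last, Fin.succ_castSucc]
  simp only [key]
  rw [Measure.volume_eq_prod, lintegral_prod_symm _ hG.aemeasurable]
  refine lintegral_congr fun z => ?_
  have hm : Measurable (fun y : X => (z (Fin.last (j + 1)), y)) :=
    measurable_const.prodMk measurable_id
  have hm2 : Measurable (fun y : X => F (j + 1) (z (Fin.last (j + 1))) y * h y) :=
    (hL.comp hm).mul hh
  rw [← lintegral_const_mul _ hm2]

theorem aux_base {X : Type*} [MeasureSpace X] [SigmaFinite (volume : Measure X)]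
    (F : ℕ → X → X → ENNReal) (h : X → ENNReal) :
    ∫⁻ z : Fin 2 → X, (∏ i : Fin 1, F i (z i.castSucc) (z i.succ)) *
        h (z (Fin.last _)) = ∫⁻ p : X × X, F 0 p.1 p.2 * h p.2 := by
  have e := (volume_preserving_finTwoArrow X)
  rw [← e.lintegral_comp_emb (MeasurableEquiv.measurableEmbedding _)]
  refine lintegral_congr fun z => ?_
  simp [MeasurableEquiv.finTwoArrow]

/-- **The model evidence as the product of the normalizing constants.**
Under the transport recursion of the decomposition theorem for state-space models, the product
of the normalizing constants `c₀ ⋯ c_k` equals the total mass `∫ ρ` of the unnormalized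
smoothing density, i.e. the marginal likelihood of the observations. -/
theorem evidence_eq_prod_normalizing_constants
    (n k : ℕ) (hn : 0 < n)
    (p₀ : (Fin n → ℝ) → ℝ)
    (q : ℕ → (Fin n → ℝ) → (Fin n → ℝ) → ℝ)
    (g : ℕ → (Fin n → ℝ) → ℝ)
    (hp₀ : Measurable p₀) (hp₀pos : ∀ z, 0 ≤ p₀ z)
    (hq : ∀ i ≤ k, Measurable (Function.uncurry (q i)))
    (hqpos : ∀ i ≤ k, ∀ z z', 0 ≤ q i z z')
    (hg : ∀ i ≤ k + 1, Measurable (g i))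
    (hgpos : ∀ i ≤ k + 1, ∀ z, 0 ≤ g i z)
    (hρpos : ∀ z, 0 < smoothingDensity (k := k) p₀ q g z)
    (hρint : Integrable (smoothingDensity (k := k) p₀ q g))
    (hρmass : 0 < ∫ z, smoothingDensity (k := k) p₀ q g z)
    (η : ℕ → Measure (Fin n → ℝ)) (e : ℕ → (Fin n → ℝ) → ℝ)
    (hηprob : ∀ i ≤ k + 1, IsProbabilityMeasure (η i))
    (hemeas : ∀ i ≤ k + 1, Measurable (e i))
    (hηd : ∀ i ≤ k + 1,
      η i = (volume : Measure (Fin n → ℝ)).withDensity (fun x => ENNReal.ofReal (e i x)))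
    (hepos : ∀ i ≤ k + 1, ∀ x, 0 < e i x)
    (M0 : ℕ → (Fin n → ℝ) × (Fin n → ℝ) → (Fin n → ℝ))
    (M1 : ℕ → (Fin n → ℝ) → (Fin n → ℝ))
    (hM0 : ∀ i ≤ k, Measurable (M0 i)) (hM1 : ∀ i ≤ k, Measurable (M1 i))
    (c : ℕ → ℝ)
    (hc0 : c 0 = ∫ p : (Fin n → ℝ) × (Fin n → ℝ), potential p₀ q g 0 p.1 p.2)
    (hf0int : Integrable (fun p : (Fin n → ℝ) × (Fin n → ℝ) => potential p₀ q g 0 p.1 p.2))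
    (hmap0 : Measure.map (fun p : (Fin n → ℝ) × (Fin n → ℝ) => (M0 0 p, M1 0 p.2))
        ((η 0).prod (η 1)) =
      (volume : Measure ((Fin n → ℝ) × (Fin n → ℝ))).withDensity
        (fun p => ENNReal.ofReal (potential p₀ q g 0 p.1 p.2 / c 0)))
    (hci : ∀ i, 1 ≤ i → i ≤ k →
      c i = ∫ p : (Fin n → ℝ) × (Fin n → ℝ),
        e i p.1 * potential p₀ q g i (M1 (i - 1) p.1) p.2)
    (hciint : ∀ i, 1 ≤ i → i ≤ k →
      Integrable (fun p : (Fin n → ℝ) × (Fin n → ℝ) =>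
        e i p.1 * potential p₀ q g i (M1 (i - 1) p.1) p.2))
    (hcipos : ∀ i, 1 ≤ i → i ≤ k → 0 < c i)
    (hmapi : ∀ i, 1 ≤ i → i ≤ k →
      Measure.map (fun p : (Fin n → ℝ) × (Fin n → ℝ) => (M0 i p, M1 i p.2))
          ((η i).prod (η (i + 1))) =
        (volume : Measure ((Fin n → ℝ) × (Fin n → ℝ))).withDensity
          (fun p => ENNReal.ofReal
            (e i p.1 * potential p₀ q g i (M1 (i - 1) p.1) p.2 / c i))) :
    ∏ i ∈ Finset.range (k + 1), c i = ∫ z, smoothingDensity (k := k) p₀ q g z := by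
  have hPm := aux_measurable (k := k) p₀ q g hp₀ hq hg
  have hPn := aux_nonneg (k := k) p₀ q g hp₀pos hqpos hgpos
  have hc0pos : 0 < c 0 := by
    have h0 : 0 ≤ c 0 := by
      rw [hc0]; exact integral_nonneg fun p => hPn 0 (by omega) _ _
    refine lt_of_le_of_ne h0 fun h => ?_
    have := hηprob 0 (by omega)
    have := hηprob 1 (by omega)
    have h00 := hM0 0 (by omega)
    have h01 := hM1 0 (by omega)
    have := congrArg (fun μ => μ Set.univ) hmap0
    simp only [← h, div_zero, ENNReal.ofReal_zero] at this
    rw [Measure.map_apply (by fun_prop) MeasurableSet.univ] at this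
    simp at this
  have hcpos : ∀ i ≤ k, 0 < c i := by
    intro i hi
    rcases Nat.eq_zero_or_pos i with rfl | h
    · exact hc0pos
    · exact hcipos i h hi
  have hFm : ∀ i ≤ k, Measurable (fun p : (Fin n → ℝ) × (Fin n → ℝ) =>
      ENNReal.ofReal (potential p₀ q g i p.1 p.2)) := fun i hi => (hPm i hi).ennreal_ofReal
  have main : ∀ j ≤ k, ∀ h : (Fin n → ℝ) → ENNReal, Measurable h →
      ENNReal.ofReal (∏ i ∈ Finset.range (j + 1), c i) * ∫⁻ y, h (M1 j y) ∂(η (j + 1)) =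
      ∫⁻ z : Fin (j + 2) → Fin n → ℝ, (∏ i : Fin (j + 1),
        ENNReal.ofReal (potential p₀ q g i (z i.castSucc) (z i.succ))) *
          h (z (Fin.last _)) := by
    intro j
    induction j with
    | zero =>
      intro hj h hh
      have := hηprob 0 (by omega)
      have := hηprob 1 (by omega)
      have hb := aux_base (fun i z z' => ENNReal.ofReal (potential p₀ q g i z z')) h
      rw [hb]
      simp only [zero_add, Finset.prod_range_one]
      exact aux_step (η 0) (η 1) (M0 0) (M1 0) (hM0 0 hj) (hM1 0 hj)
        (fun p => potential p₀ q g 0 p.1 p.2) (hPm 0 hj) (c 0) hc0pos hmap0 h hh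
    | succ j ih =>
      intro hj h hh
      have := hηprob (j + 1) (by omega)
      have := hηprob (j + 1 + 1) (by omega)
      have hm1 := hM1 j (by omega)
      have he := hemeas (j + 1) (by omega)
      have hP1 := hPm (j + 1) hj
      have hFh : Measurable (fun p : (Fin n → ℝ) × (Fin n → ℝ) =>
          ENNReal.ofReal (potential p₀ q g (j + 1) p.1 p.2) * h p.2) :=
        (hFm (j + 1) hj).mul (hh.comp measurable_snd)
      have hcomp : Measurable (fun p : (Fin n → ℝ) × (Fin n → ℝ) => (M1 j p.1, p.2)) := by
        fun_prop
      have hs := aux_split (fun i z z' => ENNReal.ofReal (potential p₀ q g i z z')) j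
        (fun i hi => hFm i (by omega)) h hh
      have hD : Measurable (fun p : (Fin n → ℝ) × (Fin n → ℝ) =>
          e (j + 1) p.1 * potential p₀ q g (j + 1) (M1 j p.1) p.2) :=
        (he.comp measurable_fst).mul (hP1.comp hcomp)
      have hst := aux_step (η (j + 1)) (η (j + 1 + 1)) (M0 (j + 1)) (M1 (j + 1))
        (hM0 _ hj) (hM1 _ hj)
        (fun p => e (j + 1) p.1 * potential p₀ q g (j + 1) (M1 j p.1) p.2) hD
        (c (j + 1)) (hcpos _ hj) (hmapi (j + 1) (by omega) hj) h hh
      have hpn : 0 ≤ ∏ i ∈ Finset.range (j + 1), c i :=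
        Finset.prod_nonneg fun i hi => (hcpos i (by
          have := Finset.mem_range.1 hi
          omega)).le
      rw [hs, ← ih (by omega) (fun w => ∫⁻ y,
          ENNReal.ofReal (potential p₀ q g (j + 1) w y) * h y) hFh.lintegral_prod_right',
        Finset.prod_range_succ, ENNReal.ofReal_mul hpn, mul_assoc, hst]
      congr 1
      have hFc : Measurable (fun p : (Fin n → ℝ) × (Fin n → ℝ) =>
          ENNReal.ofReal (potential p₀ q g (j + 1) (M1 j p.1) p.2) * h p.2) :=
        hFh.comp hcomp
      have hDh : Measurable (fun p : (Fin n → ℝ) × (Fin n → ℝ) =>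
          ENNReal.ofReal (e (j + 1) p.1 * potential p₀ q g (j + 1) (M1 j p.1) p.2) * h p.2) :=
        hD.ennreal_ofReal.mul (hh.comp measurable_snd)
      rw [hηd (j + 1) (by omega), lintegral_withDensity_eq_lintegral_mul _ (by fun_prop)
        hFc.lintegral_prod_right', Measure.volume_eq_prod,
        lintegral_prod _ hDh.aemeasurable]
      refine lintegral_congr fun x => ?_
      simp only [Pi.mul_apply]
      have hm : Measurable (fun y : Fin n → ℝ => (x, y)) :=
        measurable_const.prodMk measurable_id
      have hm2 : Measurable (fun y : Fin n → ℝ =>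
          ENNReal.ofReal (potential p₀ q g (j + 1) (M1 j x) y) * h y) := hFc.comp hm
      rw [← lintegral_const_mul _ hm2]
      refine lintegral_congr fun y => ?_
      rw [ENNReal.ofReal_mul (hepos _ (by omega) _).le, mul_assoc]
  have hfin := main k le_rfl (fun _ => 1) measurable_const
  have := hηprob (k + 1) le_rfl
  simp only [lintegral_const, measure_univ, mul_one] at hfin
  rw [integral_eq_lintegral_of_nonneg_ae (Filter.Eventually.of_forall fun z => (hρpos z).le)
    hρint.aestronglyMeasurable]
  have heq : ∀ z : Fin (k + 2) → Fin n → ℝ,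
      ENNReal.ofReal (smoothingDensity (k := k) p₀ q g z) = ∏ i : Fin (k + 1),
        ENNReal.ofReal (potential p₀ q g i (z i.castSucc) (z i.succ)) := fun z =>
    ENNReal.ofReal_prod_of_nonneg fun i _ => hPn i (by omega) _ _
  simp only [heq]
  rw [← hfin, ENNReal.toReal_ofReal]
  exact Finset.prod_nonneg fun i hi => (hcpos i (by
    have := Finset.mem_range.1 hi
    omega)).le
end

section
/- With the same joint parameter-state setup: fix n, p ≥ 1, k ≥ 0; measurable π₀ : ℝᵖ × ℝⁿ × ℝⁿ → [0,∞), q_i : ℝᵖ × ℝⁿ × ℝⁿ → [0,∞) (1 ≤ i ≤ k), g_i : ℝᵖ × ℝⁿ → [0,∞) (0 ≤ i ≤ k+1); f₀(θ,z,z') = π₀(θ,z,z') g₀(θ,z) g₁(θ,z'), f_i(θ,z,z') = q_i(θ,z,z') g_{i+1}(θ,z') for 1 ≤ i ≤ k; ρ(θ, z₀,…,z_{k+1}) = f₀(θ,z₀,z₁) ∏_{i=1}^{k} f_i(θ,z_i,z_{i+1}) strictly positive with 0 < ∫ρ < ∞; Π the probability measure with density ρ/∫ρ; references η_Θ (density e_Θ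 > 0) on ℝᵖ and η₀,…,η_{k+1} (densities e_i > 0) on ℝⁿ; and measurable maps M_i(x_θ,x,y) = (M_i^Θ(x_θ), M_i⁰(x_θ,x,y), M_i¹(x_θ,y)) satisfying c₀ := ∫ f₀, Measure.map M₀ (η_Θ ⊗ η₀ ⊗ η₁) = measure with density f₀/c₀, and for 1 ≤ i ≤ k, with 𝔗^Θ_{i-1} := M₀^Θ ∘ ⋯ ∘ M_{i-1}^Θ, c_i ∈ (0,∞) and Measure.map M_i (η_Θ ⊗ η_i ⊗ η_{i+1}) = measure with density (θ,x,y) ↦ e_Θ(θ) e_i(x) f_i(𝔗^Θ_{i-1}(θ), M_{i-1}¹(θ,x), y)/c_i. For 0 ≤ i ≤ k define T_i : ℝᵖ × (ℝⁿ)^{k+2} → ℝᵖ × (ℝⁿ)^{k+2} by T_i(x_θ, x₀,…,x_{k+1}) = (M_i^Θ(x_θ), x₀,…,x_{i-1}, M_i⁰(x_θ, x_i, x_{i+1}), M_i¹(x_θ, x_{i+1}), x_{i+2},…,x_{k+1}). Then Measure.map (T₀ ∘ ⋯ ∘ T_k) (η_Θ ⊗ η₀ ⊗ ⋯ ⊗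 η_{k+1}) = Π, i.e., the decomposable transport pushes the product reference measure forward to the full Bayesian solution π_{Θ, Z_{0:k+1} | y_{0:k+1}}. -/
open MeasureTheory ProbabilityTheory

/-- The pairwise potentials for a state-space model with static parameters `θ`:
`f₀(θ,z,z') = π₀(θ,z,z') g₀(θ,z) g₁(θ,z')` and `f_i(θ,z,z') = q_i(θ,z,z') g_{i+1}(θ,z')`
for `i ≥ 1`. -/
noncomputable def jpotential {p n : ℕ}
    (π₀ : (Fin p → ℝ) → (Fin n → ℝ) → (Fin n → ℝ) → ℝ)
    (q : ℕ → (Fin p → ℝ) → (Fin n → ℝ) → (Fin n → ℝ) → ℝ)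
    (g : ℕ → (Fin p → ℝ) → (Fin n → ℝ) → ℝ) :
    ℕ → (Fin p → ℝ) → (Fin n → ℝ) → (Fin n → ℝ) → ℝ
  | 0 => fun θ z z' => π₀ θ z z' * g 0 θ z * g 1 θ z'
  | (i + 1) => fun θ z z' => q (i + 1) θ z z' * g (i + 2) θ z'

/-- The unnormalized joint posterior density
`ρ(θ, z₀,…,z_{k+1}) = f₀(θ,z₀,z₁) ∏_{i=1}^{k} f_i(θ,z_i,z_{i+1})`. -/
noncomputable def jsmoothingDensity {p n k : ℕ}
    (π₀ : (Fin p → ℝ) → (Fin n → ℝ) → (Fin n → ℝ) → ℝ)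
    (q : ℕ → (Fin p → ℝ) → (Fin n → ℝ) → (Fin n → ℝ) → ℝ)
    (g : ℕ → (Fin p → ℝ) → (Fin n → ℝ) → ℝ)
    (w : (Fin p → ℝ) × (Fin (k + 2) → Fin n → ℝ)) : ℝ :=
  ∏ i : Fin (k + 1), jpotential π₀ q g i w.1 (w.2 i.castSucc) (w.2 i.succ)

/-- The composition `𝔗^Θ_i = M₀^Θ ∘ ⋯ ∘ M_i^Θ` (with `M_i^Θ` applied first). -/
noncomputable def thetaFlow {p : ℕ} (MΘ : ℕ → (Fin p → ℝ) → (Fin p → ℝ)) :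
    ℕ → (Fin p → ℝ) → (Fin p → ℝ)
  | 0 => MΘ 0
  | (i + 1) => thetaFlow MΘ i ∘ MΘ (i + 1)

/-- The embedding `T_i` of the block map `M_i` into the identity on `ℝᵖ × (ℝⁿ)^{k+2}`:
`T_i(x_θ, x₀,…,x_{k+1}) = (M_i^Θ(x_θ), x₀,…,x_{i-1}, M_i⁰(x_θ,x_i,x_{i+1}),
M_i¹(x_θ,x_{i+1}), x_{i+2},…,x_{k+1})`. -/
noncomputable def jstepMap {p n k : ℕ}
    (MΘ : ℕ → (Fin p → ℝ) → (Fin p → ℝ))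
    (M0 : ℕ → (Fin p → ℝ) × (Fin n → ℝ) × (Fin n → ℝ) → (Fin n → ℝ))
    (M1 : ℕ → (Fin p → ℝ) × (Fin n → ℝ) → (Fin n → ℝ)) (i : ℕ)
    (w : (Fin p → ℝ) × (Fin (k + 2) → Fin n → ℝ)) :
    (Fin p → ℝ) × (Fin (k + 2) → Fin n → ℝ) :=
  (MΘ i w.1, fun j =>
    if (j : ℕ) = i then M0 i (w.1, w.2 j, w.2 (j + 1))
    else if (j : ℕ) = i + 1 then M1 i (w.1, w.2 j)
    else w.2 j)

/-- The composition `𝔗_i = T₀ ∘ T₁ ∘ ⋯ ∘ T_i` (with `T_i` applied first). -/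
noncomputable def jbigTransport {p n k : ℕ}
    (MΘ : ℕ → (Fin p → ℝ) → (Fin p → ℝ))
    (M0 : ℕ → (Fin p → ℝ) × (Fin n → ℝ) × (Fin n → ℝ) → (Fin n → ℝ))
    (M1 : ℕ → (Fin p → ℝ) × (Fin n → ℝ) → (Fin n → ℝ)) :
    ℕ → ((Fin p → ℝ) × (Fin (k + 2) → Fin n → ℝ) →
      (Fin p → ℝ) × (Fin (k + 2) → Fin n → ℝ))
  | 0 => jstepMap MΘ M0 M1 0
  | (i + 1) => jbigTransport MΘ M0 M1 i ∘ jstepMap MΘ M0 M1 (i + 1)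


theorem aux_map_withDensity {α β : Type*} [MeasurableSpace α] [MeasurableSpace β]
    (μ : Measure α) {f : α → β} (hf : Measurable f) {H : β → ENNReal} (hH : Measurable H) :
    Measure.map f (μ.withDensity (fun a => H (f a))) = (Measure.map f μ).withDensity H := by
  ext s hs
  rw [Measure.map_apply hf hs, withDensity_apply _ (hf hs), withDensity_apply _ hs,
    setLIntegral_map hs hH hf]

theorem aux_lintegral_fin_prod {X : Type*} [MeasurableSpace X] (ν : Measure X) [SigmaFinite ν] :
    ∀ (m : ℕ) (f : Fin m → X → ENNReal), (∀ i, Measurable (f i)) →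
    ∫⁻ x : Fin m → X, ∏ i, f i (x i) ∂(Measure.pi fun _ => ν) = ∏ i, ∫⁻ x, f i x ∂ν
  | 0, f, _ => by simp
  | m + 1, f, hf => by
    have hmp := (measurePreserving_piFinSuccAbove (fun _ : Fin (m+1) => ν) 0).symm
    rw [← hmp.map_eq, lintegral_map_equiv]
    simp only [Fin.prod_univ_succ, MeasurableEquiv.piFinSuccAbove_symm_apply]
    have h := aux_lintegral_fin_prod ν m (fun i => f i.succ) (fun i => hf _)
    rw [← h, ← lintegral_prod_mul (hf 0).aemeasurable]
    · simp [Fin.insertNthEquiv]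
    · exact (Finset.measurable_prod _ fun i _ =>
        (hf i.succ).comp (measurable_pi_apply i)).aemeasurable

theorem aux_pi_withDensity {X : Type*} [MeasurableSpace X] (ν : Measure X) [SigmaFinite ν]
    (m : ℕ) (f : Fin m → X → ENNReal) (hf : ∀ i, Measurable (f i))
    [∀ i, SigmaFinite (ν.withDensity (f i))] :
    Measure.pi (fun i => ν.withDensity (f i)) =
      (Measure.pi fun _ : Fin m => ν).withDensity (fun x => ∏ i, f i (x i)) := by
  apply Measure.pi_eq
  intro s hs
  rw [withDensity_apply _ (MeasurableSet.univ_pi hs), ← lintegral_indicator (MeasurableSet.univ_pi hs)]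
  have : ∀ x : Fin m → X, (Set.univ.pi s).indicator (fun x => ∏ i, f i (x i)) x
      = ∏ i, (s i).indicator (f i) (x i) := by
    intro x
    by_cases hx : x ∈ Set.univ.pi s
    · rw [Set.indicator_of_mem hx]
      refine Finset.prod_congr rfl fun i _ => ?_
      rw [Set.indicator_of_mem (hx i trivial)]
    · rw [Set.indicator_of_notMem hx]
      simp only [Set.mem_pi, not_forall] at hx
      obtain ⟨i, _, hi⟩ := hx
      exact (Finset.prod_eq_zero (Finset.mem_univ i) (Set.indicator_of_notMem hi _)).symm
  simp_rw [this]
  rw [aux_lintegral_fin_prod ν m _ fun i => (hf i).indicator (hs i)]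
  refine Finset.prod_congr rfl fun i _ => ?_
  rw [lintegral_indicator (hs i), withDensity_apply _ (hs i)]

theorem aux_resample {ι X : Type*} [Fintype ι] [DecidableEq ι] [MeasurableSpace X]
    (μ : ι → Measure X) [∀ i, IsProbabilityMeasure (μ i)] (i : ι) :
    Measure.map (fun z : X × (ι → X) => Function.update z.2 i z.1)
      ((μ i).prod (Measure.pi μ)) = Measure.pi μ := by
  symm
  apply Measure.pi_eq
  intro s hs
  have hm : Measurable (fun z : X × (ι → X) => Function.update z.2 i z.1) := by
    rw [measurable_pi_iff]
    intro j
    by_cases h : j = i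
    · subst h; simpa using measurable_fst
    · simp only [Function.update_of_ne h]; fun_prop
  rw [Measure.map_apply hm (MeasurableSet.univ_pi hs)]
  have : (fun z : X × (ι → X) => Function.update z.2 i z.1) ⁻¹' (Set.univ.pi s)
      = (s i) ×ˢ (Set.univ.pi (Function.update s i Set.univ)) := by
    ext z
    simp only [Set.mem_preimage, Set.mem_pi, Set.mem_univ, true_imp_iff, Set.mem_prod]
    constructor
    · intro h
      refine ⟨by simpa using h i, fun j => ?_⟩
      by_cases hj : j = i
      · subst hj; simp
      · simpa [Function.update_of_ne hj] using h j
    · rintro ⟨h1, h2⟩ j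
      by_cases hj : j = i
      · subst hj; simpa using h1
      · simpa [Function.update_of_ne hj] using h2 j
  rw [this, Measure.prod_prod, Measure.pi_pi, ← Finset.mul_prod_erase _ _ (Finset.mem_univ i),
    ← Finset.mul_prod_erase _ (fun j => μ j (s j)) (Finset.mem_univ i)]
  simp only [Function.update_self, measure_univ, one_mul]
  congr 1
  refine Finset.prod_congr rfl fun j hj => ?_
  rw [Function.update_of_ne (Finset.ne_of_mem_erase hj)]

theorem aux_resample_meas {Θ ι X : Type*} [DecidableEq ι] [MeasurableSpace X]
    [MeasurableSpace Θ] (i j : ι) :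
    Measurable (fun z : (Θ × X × X) × (ι → X) =>
      (z.1.1, Function.update (Function.update z.2 j z.1.2.2) i z.1.2.1)) := by
  refine Measurable.prodMk (by fun_prop) ?_
  rw [measurable_pi_iff]
  intro l
  by_cases h : l = i
  · subst h; simp only [Function.update_self]; fun_prop
  · simp only [Function.update_of_ne h]
    by_cases h : l = j
    · subst h; simp only [Function.update_self]; fun_prop
    · simp only [Function.update_of_ne h]; fun_prop

theorem aux_resample2 {Θ ι X : Type*} [Fintype ι] [DecidableEq ι] [MeasurableSpace X]
    [MeasurableSpace Θ] (τ : Measure Θ) [IsProbabilityMeasure τ]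
    (μ : ι → Measure X) [∀ i, IsProbabilityMeasure (μ i)] (i j : ι) :
    Measure.map (fun z : (Θ × X × X) × (ι → X) =>
      (z.1.1, Function.update (Function.update z.2 j z.1.2.2) i z.1.2.1))
      ((τ.prod ((μ i).prod (μ j))).prod (Measure.pi μ)) = τ.prod (Measure.pi μ) := by
  have hu : ∀ l : ι, Measurable (fun z : X × (ι → X) => Function.update z.2 l z.1) := by
    intro l
    rw [measurable_pi_iff]
    intro j
    by_cases h : j = l
    · subst h; simpa using measurable_fst
    · simp only [Function.update_of_ne h]; fun_prop
  refine Measure.ext_of_lintegral _ fun F hF => ?_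
  rw [lintegral_map hF (aux_resample_meas i j)]
  have hR := aux_resample_meas (Θ := Θ) (X := X) i j
  have hFR : Measurable (fun z : (Θ × X × X) × (ι → X) =>
      F (z.1.1, Function.update (Function.update z.2 j z.1.2.2) i z.1.2.1)) := hF.comp hR
  have hI := hFR.lintegral_prod_right' (ν := Measure.pi μ)
  rw [lintegral_prod _ hFR.aemeasurable, lintegral_prod _ hI.aemeasurable,
    lintegral_prod _ hF.aemeasurable]
  refine lintegral_congr fun θ => ?_
  refine (lintegral_prod _ (hI.comp measurable_prodMk_left).aemeasurable).trans ?_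
  have key : ∀ (l : ι) (G : (ι → X) → ENNReal), Measurable G →
      ∫⁻ a, ∫⁻ x, G (Function.update x l a) ∂(Measure.pi μ) ∂(μ l) = ∫⁻ x, G x ∂(Measure.pi μ) := by
    intro l G hG
    conv_rhs => rw [← aux_resample μ l]
    rw [lintegral_map hG (hu l)]
    exact (lintegral_prod _ (hG.comp (hu l)).aemeasurable).symm
  have hFθ : Measurable fun x => F (θ, x) := by fun_prop
  rw [← key i _ hFθ]
  refine lintegral_congr fun a => ?_
  have : Measurable fun x : ι → X => F (θ, Function.update x i a) :=
    hFθ.comp ((hu i).comp (measurable_const.prodMk measurable_id))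
  rw [← key j _ this]
  rfl


theorem aux_ofNat_val {k j : ℕ} (h : j ≤ k + 1) : ((Fin.ofNat (k + 2) j : Fin (k + 2)) : ℕ) = j := by
  simp only [Fin.val_ofNat]; exact Nat.mod_eq_of_lt (by omega)

theorem aux_ofNat_succ {k j : ℕ} :
    (Fin.ofNat (k + 2) j : Fin (k + 2)) + 1 = Fin.ofNat (k + 2) (j + 1) := by
  apply Fin.ext
  simp [Fin.val_add]

theorem aux_step_meas {p n k : ℕ}
    {MΘ : ℕ → (Fin p → ℝ) → (Fin p → ℝ)}
    {M0 : ℕ → (Fin p → ℝ) × (Fin n → ℝ) × (Fin n → ℝ) → (Fin n → ℝ)}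
    {M1 : ℕ → (Fin p → ℝ) × (Fin n → ℝ) → (Fin n → ℝ)} {i : ℕ}
    (hMΘ : Measurable (MΘ i)) (hM0 : Measurable (M0 i)) (hM1 : Measurable (M1 i)) :
    Measurable (jstepMap (k := k) MΘ M0 M1 i) := by
  unfold jstepMap
  refine Measurable.prodMk (by fun_prop) ?_
  rw [measurable_pi_iff]
  intro j
  by_cases h : (j : ℕ) = i
  · simp only [h, if_true]; fun_prop
  · by_cases h' : (j : ℕ) = i + 1
    · simp only [h', if_true]
      simp only [Nat.add_eq_left, one_ne_zero, if_false]
      fun_prop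
    · simp only [h, h', if_false]; fun_prop

theorem aux_step_s11 {p n k : ℕ} (τ : Measure (Fin p → ℝ)) [IsProbabilityMeasure τ]
    (η : ℕ → Measure (Fin n → ℝ)) (hη : ∀ i ≤ k + 1, IsProbabilityMeasure (η i))
    (MΘ : ℕ → (Fin p → ℝ) → (Fin p → ℝ))
    (M0 : ℕ → (Fin p → ℝ) × (Fin n → ℝ) × (Fin n → ℝ) → (Fin n → ℝ))
    (M1 : ℕ → (Fin p → ℝ) × (Fin n → ℝ) → (Fin n → ℝ)) (i : ℕ) (hi : i ≤ k)
    (hMΘ : Measurable (MΘ i)) (hM0 : Measurable (M0 i)) (hM1 : Measurable (M1 i))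
    (φ : (Fin p → ℝ) × (Fin n → ℝ) × (Fin n → ℝ) → ENNReal) (hφ : Measurable φ)
    (h : Measure.map (fun w : (Fin p → ℝ) × (Fin n → ℝ) × (Fin n → ℝ) =>
            (MΘ i w.1, M0 i w, M1 i (w.1, w.2.2)))
          (τ.prod ((η i).prod (η (i + 1)))) =
          (τ.prod ((η i).prod (η (i + 1)))).withDensity φ) :
    Measure.map (jstepMap (k := k) MΘ M0 M1 i) (τ.prod (Measure.pi (fun j : Fin (k + 2) => η j)))
      = (τ.prod (Measure.pi (fun j : Fin (k + 2) => η j))).withDensity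
        (fun w => φ (w.1, w.2 (Fin.ofNat _ i), w.2 (Fin.ofNat _ (i + 1)))) := by
  have : ∀ j : Fin (k + 2), IsProbabilityMeasure (η j) := fun j => hη _ (by omega)
  have := hη i (by omega)
  have := hη (i + 1) (by omega)
  have va := aux_ofNat_val (k := k) (j := i) (by omega)
  have vb := aux_ofNat_val (k := k) (j := i + 1) (by omega)
  have hs := aux_ofNat_succ (k := k) (j := i)
  generalize Fin.ofNat (k + 2) i = a at *
  generalize Fin.ofNat (k + 2) (i + 1) = b at *
  have hab : b ≠ a := fun h => by rw [h] at vb; omega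
  have hR := aux_resample2 τ (fun j : Fin (k + 2) => η j) a b
  simp only [va, vb] at hR
  have hRm := aux_resample_meas (Θ := Fin p → ℝ) (X := Fin n → ℝ) a b
  have hT := aux_step_meas (k := k) hMΘ hM0 hM1
  have hB : Measurable (fun w : (Fin p → ℝ) × (Fin n → ℝ) × (Fin n → ℝ) =>
            (MΘ i w.1, M0 i w, M1 i (w.1, w.2.2))) := by fun_prop
  have hφ' : Measurable (fun w : (Fin p → ℝ) × (Fin (k + 2) → Fin n → ℝ) =>
      φ (w.1, w.2 a, w.2 b)) := by fun_prop
  conv_lhs => rw [← hR]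
  rw [Measure.map_map hT hRm]
  have hcomp : jstepMap (k := k) MΘ M0 M1 i ∘
      (fun z : ((Fin p → ℝ) × (Fin n → ℝ) × (Fin n → ℝ)) × (Fin (k + 2) → Fin n → ℝ) =>
        (z.1.1, Function.update (Function.update z.2 b z.1.2.2) a z.1.2.1)) =
      (fun z : ((Fin p → ℝ) × (Fin n → ℝ) × (Fin n → ℝ)) × (Fin (k + 2) → Fin n → ℝ) =>
        (z.1.1, Function.update (Function.update z.2 b z.1.2.2) a z.1.2.1)) ∘
      Prod.map (fun w : (Fin p → ℝ) × (Fin n → ℝ) × (Fin n → ℝ) =>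
            (MΘ i w.1, M0 i w, M1 i (w.1, w.2.2))) id := by
    funext z
    refine Prod.ext rfl ?_
    funext j
    simp only [jstepMap, Function.comp, Prod.map, id]
    by_cases h1 : j = a
    · subst h1
      simp [va, hs, hab]
    · have h1' : (j : ℕ) ≠ i := fun h => h1 (Fin.ext (by omega))
      by_cases h2 : j = b
      · subst h2
        simp [vb, hab]
      · have h2' : (j : ℕ) ≠ i + 1 := fun h => h2 (Fin.ext (by omega))
        simp [h1, h2, h1', h2']
  rw [hcomp, ← Measure.map_map hRm (hB.prodMap measurable_id), ← Measure.map_prod_map _ _ hB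
    measurable_id, h, Measure.map_id, prod_withDensity_left hφ]
  have := aux_map_withDensity ((τ.prod ((η i).prod (η (i + 1)))).prod
    (Measure.pi (fun j : Fin (k + 2) => η j))) hRm hφ'
  rw [hR] at this
  rw [← this]
  simp [hab]

theorem aux_big_fst {p n k : ℕ} (MΘ : ℕ → (Fin p → ℝ) → (Fin p → ℝ))
    (M0 : ℕ → (Fin p → ℝ) × (Fin n → ℝ) × (Fin n → ℝ) → (Fin n → ℝ))
    (M1 : ℕ → (Fin p → ℝ) × (Fin n → ℝ) → (Fin n → ℝ)) :
    ∀ (i : ℕ) (w : (Fin p → ℝ) × (Fin (k + 2) → Fin n → ℝ)),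
    (jbigTransport MΘ M0 M1 i w).1 = thetaFlow MΘ i w.1
  | 0, w => rfl
  | i + 1, w => by
    simp only [jbigTransport, thetaFlow, Function.comp]
    rw [aux_big_fst MΘ M0 M1 i]; rfl

theorem aux_big_later {p n k : ℕ} (MΘ : ℕ → (Fin p → ℝ) → (Fin p → ℝ))
    (M0 : ℕ → (Fin p → ℝ) × (Fin n → ℝ) × (Fin n → ℝ) → (Fin n → ℝ))
    (M1 : ℕ → (Fin p → ℝ) × (Fin n → ℝ) → (Fin n → ℝ)) :
    ∀ (i : ℕ) (w : (Fin p → ℝ) × (Fin (k + 2) → Fin n → ℝ)) (j : Fin (k + 2)), i + 2 ≤ j →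
    (jbigTransport MΘ M0 M1 i w).2 j = w.2 j
  | 0, w, j, hj => by
    simp only [jbigTransport, jstepMap]
    rw [if_neg (by omega), if_neg (by omega)]
  | i + 1, w, j, hj => by
    simp only [jbigTransport, Function.comp]
    rw [aux_big_later MΘ M0 M1 i _ j (by omega)]
    simp only [jstepMap]
    rw [if_neg (by omega), if_neg (by omega)]

theorem aux_big_mid {p n k : ℕ} (MΘ : ℕ → (Fin p → ℝ) → (Fin p → ℝ))
    (M0 : ℕ → (Fin p → ℝ) × (Fin n → ℝ) × (Fin n → ℝ) → (Fin n → ℝ))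
    (M1 : ℕ → (Fin p → ℝ) × (Fin n → ℝ) → (Fin n → ℝ))
    (i : ℕ) (w : (Fin p → ℝ) × (Fin (k + 2) → Fin n → ℝ)) (j : Fin (k + 2)) (hj : (j : ℕ) = i + 1) :
    (jbigTransport MΘ M0 M1 i w).2 j = M1 i (w.1, w.2 j) := by
  cases i with
  | zero =>
    simp only [jbigTransport, jstepMap]
    rw [if_neg (by omega), if_pos (by omega)]
  | succ i =>
    simp only [jbigTransport, Function.comp]
    rw [aux_big_later MΘ M0 M1 i _ j (by omega)]
    simp only [jstepMap]
    rw [if_neg (by omega), if_pos (by omega)]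

theorem aux_big_meas {p n k : ℕ} {MΘ : ℕ → (Fin p → ℝ) → (Fin p → ℝ)}
    {M0 : ℕ → (Fin p → ℝ) × (Fin n → ℝ) × (Fin n → ℝ) → (Fin n → ℝ)}
    {M1 : ℕ → (Fin p → ℝ) × (Fin n → ℝ) → (Fin n → ℝ)}
    (hMΘ : ∀ i ≤ k, Measurable (MΘ i))
    (hM0 : ∀ i ≤ k, Measurable (M0 i)) (hM1 : ∀ i ≤ k, Measurable (M1 i)) :
    ∀ i ≤ k, Measurable (jbigTransport (k := k) MΘ M0 M1 i)
  | 0, h => aux_step_meas (hMΘ 0 h) (hM0 0 h) (hM1 0 h)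
  | i + 1, h => (aux_big_meas hMΘ hM0 hM1 i (by omega)).comp
      (aux_step_meas (hMΘ _ h) (hM0 _ h) (hM1 _ h))

theorem aux_flow_meas {p k : ℕ} {MΘ : ℕ → (Fin p → ℝ) → (Fin p → ℝ)}
    (hMΘ : ∀ i ≤ k, Measurable (MΘ i)) : ∀ i ≤ k, Measurable (thetaFlow MΘ i)
  | 0, h => hMΘ 0 h
  | i + 1, h => (aux_flow_meas hMΘ i (by omega)).comp (hMΘ _ h)


theorem aux_pot_meas {p n k : ℕ}
    {π₀ : (Fin p → ℝ) → (Fin n → ℝ) → (Fin n → ℝ) → ℝ}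
    {q : ℕ → (Fin p → ℝ) → (Fin n → ℝ) → (Fin n → ℝ) → ℝ}
    {g : ℕ → (Fin p → ℝ) → (Fin n → ℝ) → ℝ}
    (hπ₀ : Measurable (fun w : (Fin p → ℝ) × (Fin n → ℝ) × (Fin n → ℝ) => π₀ w.1 w.2.1 w.2.2))
    (hq : ∀ i, 1 ≤ i → i ≤ k →
      Measurable (fun w : (Fin p → ℝ) × (Fin n → ℝ) × (Fin n → ℝ) => q i w.1 w.2.1 w.2.2))
    (hg : ∀ i ≤ k + 1, Measurable (fun w : (Fin p → ℝ) × (Fin n → ℝ) => g i w.1 w.2)) :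
    ∀ i ≤ k, Measurable (fun w : (Fin p → ℝ) × (Fin n → ℝ) × (Fin n → ℝ) =>
      jpotential π₀ q g i w.1 w.2.1 w.2.2) := by
  intro i hi
  cases i with
  | zero =>
    simp only [jpotential]
    exact (hπ₀.mul ((hg 0 (by omega)).comp (g := fun w : (Fin p → ℝ) × (Fin n → ℝ) => g 0 w.1 w.2)
      (f := fun w : (Fin p → ℝ) × (Fin n → ℝ) × (Fin n → ℝ) => (w.1, w.2.1)) (by fun_prop))).mul
      ((hg 1 (by omega)).comp (g := fun w : (Fin p → ℝ) × (Fin n → ℝ) => g 1 w.1 w.2)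
      (f := fun w : (Fin p → ℝ) × (Fin n → ℝ) × (Fin n → ℝ) => (w.1, w.2.2)) (by fun_prop))
  | succ i =>
    simp only [jpotential]
    exact (hq _ (by omega) hi).mul
      ((hg (i + 2) (by omega)).comp (g := fun w : (Fin p → ℝ) × (Fin n → ℝ) => g (i + 2) w.1 w.2)
      (f := fun w : (Fin p → ℝ) × (Fin n → ℝ) × (Fin n → ℝ) => (w.1, w.2.2)) (by fun_prop))

/-- **The full Bayesian solution for joint parameter and state estimation.**
Under the transport recursion of the decomposition theorem for joint parameter and state
estimation, the decomposable transport `T₀ ∘ ⋯ ∘ T_k` pushes the product reference measure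
`η_Θ ⊗ η₀ ⊗ ⋯ ⊗ η_{k+1}` forward to the joint posterior `Π`. -/
theorem joint_full_bayesian_solution_of_recursion
    (p n k : ℕ) (hp : 0 < p) (hn : 0 < n)
    (π₀ : (Fin p → ℝ) → (Fin n → ℝ) → (Fin n → ℝ) → ℝ)
    (q : ℕ → (Fin p → ℝ) → (Fin n → ℝ) → (Fin n → ℝ) → ℝ)
    (g : ℕ → (Fin p → ℝ) → (Fin n → ℝ) → ℝ)
    (hπ₀ : Measurable (fun w : (Fin p → ℝ) × (Fin n → ℝ) × (Fin n → ℝ) => π₀ w.1 w.2.1 w.2.2))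
    (hπ₀pos : ∀ θ z z', 0 ≤ π₀ θ z z')
    (hq : ∀ i, 1 ≤ i → i ≤ k →
      Measurable (fun w : (Fin p → ℝ) × (Fin n → ℝ) × (Fin n → ℝ) => q i w.1 w.2.1 w.2.2))
    (hqpos : ∀ i, 1 ≤ i → i ≤ k → ∀ θ z z', 0 ≤ q i θ z z')
    (hg : ∀ i ≤ k + 1, Measurable (fun w : (Fin p → ℝ) × (Fin n → ℝ) => g i w.1 w.2))
    (hgpos : ∀ i ≤ k + 1, ∀ θ z, 0 ≤ g i θ z)
    (hρpos : ∀ w, 0 < jsmoothingDensity (k := k) π₀ q g w)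
    (hρint : Integrable (jsmoothingDensity (k := k) π₀ q g))
    (hρmass : 0 < ∫ w, jsmoothingDensity (k := k) π₀ q g w)
    (ηΘ : Measure (Fin p → ℝ)) (eΘ : (Fin p → ℝ) → ℝ)
    (hηΘprob : IsProbabilityMeasure ηΘ) (heΘmeas : Measurable eΘ)
    (hηΘd : ηΘ = (volume : Measure (Fin p → ℝ)).withDensity (fun θ => ENNReal.ofReal (eΘ θ)))
    (heΘpos : ∀ θ, 0 < eΘ θ)
    (η : ℕ → Measure (Fin n → ℝ)) (e : ℕ → (Fin n → ℝ) → ℝ)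
    (hηprob : ∀ i ≤ k + 1, IsProbabilityMeasure (η i))
    (hemeas : ∀ i ≤ k + 1, Measurable (e i))
    (hηd : ∀ i ≤ k + 1,
      η i = (volume : Measure (Fin n → ℝ)).withDensity (fun x => ENNReal.ofReal (e i x)))
    (hepos : ∀ i ≤ k + 1, ∀ x, 0 < e i x)
    (MΘ : ℕ → (Fin p → ℝ) → (Fin p → ℝ))
    (M0 : ℕ → (Fin p → ℝ) × (Fin n → ℝ) × (Fin n → ℝ) → (Fin n → ℝ))
    (M1 : ℕ → (Fin p → ℝ) × (Fin n → ℝ) → (Fin n → ℝ))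
    (hMΘ : ∀ i ≤ k, Measurable (MΘ i))
    (hM0 : ∀ i ≤ k, Measurable (M0 i)) (hM1 : ∀ i ≤ k, Measurable (M1 i))
    (c : ℕ → ℝ)
    (hc0 : c 0 = ∫ w : (Fin p → ℝ) × (Fin n → ℝ) × (Fin n → ℝ),
      jpotential π₀ q g 0 w.1 w.2.1 w.2.2)
    (hf0int : Integrable (fun w : (Fin p → ℝ) × (Fin n → ℝ) × (Fin n → ℝ) =>
      jpotential π₀ q g 0 w.1 w.2.1 w.2.2))
    (hmap0 : Measure.map
        (fun w : (Fin p → ℝ) × (Fin n → ℝ) × (Fin n → ℝ) =>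
          (MΘ 0 w.1, M0 0 w, M1 0 (w.1, w.2.2)))
        (ηΘ.prod ((η 0).prod (η 1))) =
      (volume : Measure ((Fin p → ℝ) × (Fin n → ℝ) × (Fin n → ℝ))).withDensity
        (fun w => ENNReal.ofReal (jpotential π₀ q g 0 w.1 w.2.1 w.2.2 / c 0)))
    (hci : ∀ i, 1 ≤ i → i ≤ k →
      c i = ∫ w : (Fin p → ℝ) × (Fin n → ℝ) × (Fin n → ℝ),
        eΘ w.1 * e i w.2.1 *
          jpotential π₀ q g i (thetaFlow MΘ (i - 1) w.1) (M1 (i - 1) (w.1, w.2.1)) w.2.2)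
    (hciint : ∀ i, 1 ≤ i → i ≤ k →
      Integrable (fun w : (Fin p → ℝ) × (Fin n → ℝ) × (Fin n → ℝ) =>
        eΘ w.1 * e i w.2.1 *
          jpotential π₀ q g i (thetaFlow MΘ (i - 1) w.1) (M1 (i - 1) (w.1, w.2.1)) w.2.2))
    (hcipos : ∀ i, 1 ≤ i → i ≤ k → 0 < c i)
    (hmapi : ∀ i, 1 ≤ i → i ≤ k →
      Measure.map
          (fun w : (Fin p → ℝ) × (Fin n → ℝ) × (Fin n → ℝ) =>
            (MΘ i w.1, M0 i w, M1 i (w.1, w.2.2)))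
          (ηΘ.prod ((η i).prod (η (i + 1)))) =
        (volume : Measure ((Fin p → ℝ) × (Fin n → ℝ) × (Fin n → ℝ))).withDensity
          (fun w => ENNReal.ofReal
            (eΘ w.1 * e i w.2.1 *
              jpotential π₀ q g i (thetaFlow MΘ (i - 1) w.1) (M1 (i - 1) (w.1, w.2.1)) w.2.2
              / c i))) :
    Measure.map (jbigTransport (k := k) MΘ M0 M1 k)
        (ηΘ.prod (Measure.pi (fun i : Fin (k + 2) => η i))) =
      (volume : Measure ((Fin p → ℝ) × (Fin (k + 2) → Fin n → ℝ))).withDensity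
        (fun w => ENNReal.ofReal (jsmoothingDensity (k := k) π₀ q g w /
          ∫ w, jsmoothingDensity (k := k) π₀ q g w)) := by
  have hfm := aux_pot_meas hπ₀ hq hg
  have hfn : ∀ i ≤ k, ∀ θ z z', 0 ≤ jpotential π₀ q g i θ z z' := by
    intro i hi θ z z'
    cases i with
    | zero => exact mul_nonneg (mul_nonneg (hπ₀pos _ _ _) (hgpos _ (by omega) _ _))
                (hgpos _ (by omega) _ _)
    | succ i => exact mul_nonneg (hqpos _ (by omega) hi _ _ _) (hgpos _ (by omega) _ _)
  have hc0n : 0 ≤ c 0 := by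
    rw [hc0]; exact integral_nonneg fun w => hfn 0 (by omega) _ _ _
  have hcn : ∀ i ≤ k, 0 ≤ c i := by
    intro i hi
    cases i with
    | zero => exact hc0n
    | succ i => exact (hcipos _ (by omega) hi).le
  have hρ : ∀ w : (Fin p → ℝ) × (Fin (k + 2) → Fin n → ℝ), jsmoothingDensity (k := k) π₀ q g w =
      ∏ j ∈ Finset.range (k + 1),
        jpotential π₀ q g j w.1 (w.2 (Fin.ofNat _ j)) (w.2 (Fin.ofNat _ (j + 1))) := by
    intro w
    rw [Finset.prod_range, jsmoothingDensity]
    refine Finset.prod_congr rfl fun j _ => ?_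
    have h1 : j.castSucc = Fin.ofNat (k + 2) j :=
      Fin.ext (by rw [aux_ofNat_val (by omega)]; simp)
    have h2 : j.succ = Fin.ofNat (k + 2) (j + 1) :=
      Fin.ext (by rw [aux_ofNat_val (by omega)]; simp)
    rw [h1, h2]
  have hprod : ∀ x : Fin (k + 2) → Fin n → ℝ, ∏ j : Fin (k + 2), e j (x j) =
      ∏ j ∈ Finset.range (k + 2), e j (x (Fin.ofNat _ j)) := by
    intro x
    rw [Finset.prod_range]
    refine Finset.prod_congr rfl fun j _ => ?_
    have h1 : j = Fin.ofNat (k + 2) j :=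
      Fin.ext (by rw [aux_ofNat_val (by omega)])
    rw [← h1]
  have hηp : ∀ j : Fin (k + 2), IsProbabilityMeasure (η j) := fun j => hηprob _ (by omega)
  -- the three-block reference measure
  have hμ3 : ∀ i ≤ k, ηΘ.prod ((η i).prod (η (i + 1))) =
      (volume : Measure ((Fin p → ℝ) × (Fin n → ℝ) × (Fin n → ℝ))).withDensity
        (fun w => ENNReal.ofReal (eΘ w.1 * (e i w.2.1 * e (i + 1) w.2.2))) := by
    intro i hi
    have m1 := hemeas i (by omega)
    have m2 := hemeas (i + 1) (by omega)
    rw [hηΘd, hηd i (by omega), hηd (i + 1) (by omega), prod_withDensity (by fun_prop) (by fun_prop),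
      prod_withDensity (by fun_prop) (by fun_prop), ← Measure.volume_eq_prod,
      ← Measure.volume_eq_prod]
    congr 1
    funext w
    rw [ENNReal.ofReal_mul (heΘpos _).le, ENNReal.ofReal_mul (hepos i (by omega) _).le]
  have hfull : ηΘ.prod (Measure.pi (fun i : Fin (k + 2) => η i)) =
      (volume : Measure ((Fin p → ℝ) × (Fin (k + 2) → Fin n → ℝ))).withDensity
        (fun w => ENNReal.ofReal
          (eΘ w.1 * ∏ j ∈ Finset.range (k + 2), e j (w.2 (Fin.ofNat _ j)))) := by
    have hm : ∀ j : Fin (k + 2), Measurable (e j) := fun j => hemeas _ (by omega)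
    have h1 : (fun i : Fin (k + 2) => η i) = fun i : Fin (k + 2) =>
        (volume : Measure (Fin n → ℝ)).withDensity (fun x => ENNReal.ofReal (e i x)) :=
      funext fun j => hηd j (by omega)
    have hsf : ∀ j : Fin (k + 2), SigmaFinite
        ((volume : Measure (Fin n → ℝ)).withDensity (fun x => ENNReal.ofReal (e j x))) := by
      intro j; rw [← hηd j (by omega)]; infer_instance
    rw [h1, aux_pi_withDensity _ _ _ (fun j => by fun_prop), hηΘd,
      prod_withDensity (by fun_prop) (by fun_prop), ← volume_pi, ← Measure.volume_eq_prod]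
    congr 1
    funext w
    rw [ENNReal.ofReal_mul (heΘpos _).le, ← hprod,
      ENNReal.ofReal_prod_of_nonneg (fun (j : Fin (k + 2)) _ => (hepos j (by omega) (w.2 j)).le)]
  -- measurability of the coordinate potentials
  have hFm : ∀ i ≤ k, Measurable (fun w : (Fin p → ℝ) × (Fin (k + 2) → Fin n → ℝ) =>
      jpotential π₀ q g i w.1 (w.2 (Fin.ofNat _ i)) (w.2 (Fin.ofNat _ (i + 1)))) := fun i hi =>
    (hfm i hi).comp (f := fun w : (Fin p → ℝ) × (Fin (k + 2) → Fin n → ℝ) =>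
      (w.1, w.2 (Fin.ofNat _ i), w.2 (Fin.ofNat _ (i + 1)))) (by fun_prop)
  have hEm : ∀ i ≤ k + 1, Measurable (fun w : (Fin p → ℝ) × (Fin (k + 2) → Fin n → ℝ) =>
      e i (w.2 (Fin.ofNat _ i))) := fun i hi => (hemeas i hi).comp (by fun_prop)
  have hDm : ∀ i ≤ k, Measurable (fun w : (Fin p → ℝ) × (Fin (k + 2) → Fin n → ℝ) =>
        (∏ j ∈ Finset.range (i + 1),
          jpotential π₀ q g j w.1 (w.2 (Fin.ofNat _ j)) (w.2 (Fin.ofNat _ (j + 1))) / c j) /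
        (eΘ w.1 * ∏ j ∈ Finset.range (i + 2), e j (w.2 (Fin.ofNat _ j)))) := by
    intro i hi
    refine Measurable.div ?_ (Measurable.mul (by fun_prop) ?_)
    · exact Finset.measurable_prod _ fun j hj => (hFm j (by
        have := Finset.mem_range.1 hj; omega)).div_const _
    · exact Finset.measurable_prod _ fun j hj => hEm j (by
        have := Finset.mem_range.1 hj; omega)
  -- main induction
  have main : ∀ i ≤ k, Measure.map (jbigTransport (k := k) MΘ M0 M1 i)
        (ηΘ.prod (Measure.pi (fun i : Fin (k + 2) => η i))) =
      (ηΘ.prod (Measure.pi (fun i : Fin (k + 2) => η i))).withDensity (fun w => ENNReal.ofReal (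
        (∏ j ∈ Finset.range (i + 1),
          jpotential π₀ q g j w.1 (w.2 (Fin.ofNat _ j)) (w.2 (Fin.ofNat _ (j + 1))) / c j) /
        (eΘ w.1 * ∏ j ∈ Finset.range (i + 2), e j (w.2 (Fin.ofNat _ j))))) := by
    intro i
    induction i with
    | zero =>
      intro hi
      have m1 := hemeas 0 (by omega)
      have m2 := hemeas 1 (by omega)
      have mf := hfm 0 hi
      have hφ : Measurable (fun w : (Fin p → ℝ) × (Fin n → ℝ) × (Fin n → ℝ) =>
          ENNReal.ofReal (jpotential π₀ q g 0 w.1 w.2.1 w.2.2 / c 0 /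
            (eΘ w.1 * (e 0 w.2.1 * e 1 w.2.2)))) :=
        ((mf.div_const _).div (by fun_prop)).ennreal_ofReal
      have := aux_step_s11 (k := k) ηΘ η hηprob MΘ M0 M1 0 hi (hMΘ 0 hi) (hM0 0 hi) (hM1 0 hi) _ hφ (by
        rw [hmap0, hμ3 0 hi, ← withDensity_mul _ (by fun_prop) hφ]
        congr 1
        funext w
        have a1 := heΘpos w.1
        have a2 := hepos 0 (by omega) w.2.1
        have a3 := hepos 1 (by omega) w.2.2
        rw [Pi.mul_apply, ← ENNReal.ofReal_mul (by positivity)]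
        congr 1
        simp only [zero_add]
        rw [mul_div_cancel₀ _ (by positivity)])
      simp only [jbigTransport]
      rw [this]
      congr 1
      funext w
      simp [Finset.prod_range_succ]
    | succ i ih =>
      intro hi
      have ih := ih (by omega)
      have m1 := hemeas (i + 1) (by omega)
      have m2 := hemeas (i + 1 + 1) (by omega)
      have mfl := aux_flow_meas hMΘ i (by omega)
      have mM1 := hM1 i (by omega)
      have mf := hfm (i + 1) hi
      have hmi := hmapi (i + 1) (by omega) hi
      simp only [Nat.add_sub_cancel] at hmi
      have hφ : Measurable (fun w : (Fin p → ℝ) × (Fin n → ℝ) × (Fin n → ℝ) =>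
          ENNReal.ofReal (jpotential π₀ q g (i + 1) (thetaFlow MΘ i w.1) (M1 i (w.1, w.2.1)) w.2.2
            / c (i + 1) / e (i + 1 + 1) w.2.2)) :=
        (((mf.comp (f := fun w : (Fin p → ℝ) × (Fin n → ℝ) × (Fin n → ℝ) =>
          (thetaFlow MΘ i w.1, M1 i (w.1, w.2.1), w.2.2)) (by fun_prop)).div_const _).div
            (by fun_prop)).ennreal_ofReal
      have hst := aux_step_s11 (k := k) ηΘ η hηprob MΘ M0 M1 (i + 1) hi (hMΘ _ hi) (hM0 _ hi)
        (hM1 _ hi) _ hφ (by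
        rw [hmi, hμ3 (i + 1) hi, ← withDensity_mul _ (by fun_prop) hφ]
        congr 1
        funext w
        have a1 := heΘpos w.1
        have a2 := hepos (i + 1) (by omega) w.2.1
        have a3 := hepos (i + 1 + 1) (by omega) w.2.2
        rw [Pi.mul_apply, ← ENNReal.ofReal_mul (by positivity)]
        congr 1
        have a3' := a3.ne'
        generalize jpotential π₀ q g (i + 1) (thetaFlow MΘ i w.1) (M1 i (w.1, w.2.1)) w.2.2 = F
        have : e (i + 1 + 1) w.2.2 * (F / c (i + 1) / e (i + 1 + 1) w.2.2) = F / c (i + 1) :=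
          mul_div_cancel₀ _ a3'
        rw [mul_assoc (eΘ w.1) (e (i + 1) w.2.1 * _), mul_assoc (e (i + 1) w.2.1) (e (i + 1 + 1) w.2.2), this]
        ring)
      have hbm := aux_big_meas (k := k) hMΘ hM0 hM1 i (by omega)
      have hsm := aux_step_meas (k := k) (hMΘ _ hi) (hM0 _ hi) (hM1 _ hi)
      have hHm : Measurable (fun w : (Fin p → ℝ) × (Fin (k + 2) → Fin n → ℝ) =>
          ENNReal.ofReal (jpotential π₀ q g (i + 1) w.1 (w.2 (Fin.ofNat _ (i + 1)))
            (w.2 (Fin.ofNat _ (i + 1 + 1))) / c (i + 1) /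
              e (i + 1 + 1) (w.2 (Fin.ofNat _ (i + 1 + 1))))) :=
        (((hFm _ hi).div_const _).div (hEm _ (by omega))).ennreal_ofReal
      have hw := aux_map_withDensity (ηΘ.prod (Measure.pi (fun i : Fin (k + 2) => η i))) hbm hHm
      simp only [aux_big_fst,
        aux_big_mid MΘ M0 M1 i _ (Fin.ofNat (k + 2) (i + 1)) (aux_ofNat_val (by omega)),
        aux_big_later MΘ M0 M1 i _ (Fin.ofNat (k + 2) (i + 1 + 1))
          (by rw [aux_ofNat_val (by omega)])] at hw
      simp only [jbigTransport]
      rw [← Measure.map_map hbm hsm, hst, hw, ih,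
        ← withDensity_mul _ (hDm i (by omega)).ennreal_ofReal hHm]
      congr 1
      funext w
      have a1 := heΘpos w.1
      have a2 : 0 < ∏ j ∈ Finset.range (i + 2), e j (w.2 (Fin.ofNat _ j)) :=
        Finset.prod_pos fun j hj => hepos j (by have := Finset.mem_range.1 hj; omega) _
      have a3 : 0 ≤ ∏ j ∈ Finset.range (i + 1),
          jpotential π₀ q g j w.1 (w.2 (Fin.ofNat _ j)) (w.2 (Fin.ofNat _ (j + 1))) / c j :=
        Finset.prod_nonneg fun j hj => by
          have := Finset.mem_range.1 hj
          exact div_nonneg (hfn j (by omega) _ _ _) (hcn j (by omega))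
      rw [Pi.mul_apply, ← ENNReal.ofReal_mul (by positivity),
        Finset.prod_range_succ _ (i + 1), Finset.prod_range_succ _ (i + 2), div_mul_div_comm,
        mul_assoc (eΘ w.1), Finset.prod_range_succ _ (i + 1), Finset.prod_range_succ _ (i + 1)]
  have hfin := main k le_rfl
  have hP : IsProbabilityMeasure (Measure.map (jbigTransport (k := k) MΘ M0 M1 k)
        (ηΘ.prod (Measure.pi (fun i : Fin (k + 2) => η i)))) :=
    Measure.isProbabilityMeasure_map (aux_big_meas hMΘ hM0 hM1 k le_rfl).aemeasurable
  have hlast : Measure.map (jbigTransport (k := k) MΘ M0 M1 k)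
        (ηΘ.prod (Measure.pi (fun i : Fin (k + 2) => η i))) =
      (volume : Measure ((Fin p → ℝ) × (Fin (k + 2) → Fin n → ℝ))).withDensity
        (fun w => ENNReal.ofReal (jsmoothingDensity (k := k) π₀ q g w /
          ∏ j ∈ Finset.range (k + 1), c j)) := by
    rw [hfin]
    conv_lhs => rw [hfull]
    rw [← withDensity_mul _ _ (hDm k le_rfl).ennreal_ofReal]
    · congr 1
      funext w
      have a1 := heΘpos w.1
      have a2 : 0 < ∏ j ∈ Finset.range (k + 2), e j (w.2 (Fin.ofNat _ j)) :=
        Finset.prod_pos fun j hj => hepos j (by have := Finset.mem_range.1 hj; omega) _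
      rw [Pi.mul_apply, ← ENNReal.ofReal_mul (by positivity), mul_div_cancel₀ _ (by positivity),
        Finset.prod_div_distrib, hρ]
    · exact (Measurable.mul (by fun_prop) (Finset.measurable_prod _ fun j hj => hEm j (by
        have := Finset.mem_range.1 hj; omega))).ennreal_ofReal
  have hCn : 0 ≤ ∏ j ∈ Finset.range (k + 1), c j :=
    Finset.prod_nonneg fun j hj => hcn j (by have := Finset.mem_range.1 hj; omega)
  have hmass : (∫ w, jsmoothingDensity (k := k) π₀ q g w) / ∏ j ∈ Finset.range (k + 1), c j = 1 := by
    have h1 := hP.measure_univ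
    rw [hlast, withDensity_apply _ MeasurableSet.univ, Measure.restrict_univ,
      ← ofReal_integral_eq_lintegral_ofReal (hρint.div_const _)
        (Filter.Eventually.of_forall fun w => div_nonneg (hρpos w).le hCn),
      integral_div, ENNReal.ofReal_eq_one] at h1
    exact h1
  have hCeq : ∏ j ∈ Finset.range (k + 1), c j = ∫ w, jsmoothingDensity (k := k) π₀ q g w := by
    have h0 : ∏ j ∈ Finset.range (k + 1), c j ≠ 0 := by
      intro h; rw [h, div_zero] at hmass; exact zero_ne_one hmass
    exact ((div_eq_one_iff_eq h0).1 hmass).symm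
  rw [hlast, hCeq]
end

section
/- Let n ≥ 1, let η = ⊗_k η_k be a product of Borel probability measures on ℝ, each absolutely continuous with a.e. strictly positive density, and let π be a Borel probability measure on ℝⁿ = (Fin n → ℝ), absolutely continuous with a.e. strictly positive density. Let A ⊆ {1,…,n} be such that, under π, the coordinate projections x ↦ x|_A and x ↦ x|_{Aᶜ} are independent, and the joint law of the A-coordinates under π equals their joint law under η. Then for every permutation σ of {1,…,n} there exists a σ-triangular, monotone increasing map T : ℝⁿ → ℝⁿ with Measure.map T η = π that is low-dimensional with respect to A, i.e.: T(x)_k = x_k for every k ∈ A, and for every k ∉ A the component T(·)_k does not depend on coordinate j for any j ∈ A. -/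
open MeasureTheory ProbabilityTheory

/-- A map `T : ℝⁿ → ℝⁿ` is `σ`-triangular for a permutation `σ` of `{1,…,n}` if its
`σ(k)`-th component depends only on the coordinates `x_{σ(1)},…,x_{σ(k)}`. -/
def SigmaTriangular {n : ℕ} (σ : Equiv.Perm (Fin n)) (T : (Fin n → ℝ) → (Fin n → ℝ)) : Prop :=
  ∀ (k : Fin n) (x y : Fin n → ℝ),
    (∀ m : Fin n, m ≤ k → x (σ m) = y (σ m)) → T x (σ k) = T y (σ k)

/-- A `σ`-triangular map is monotone increasing if each component `T(·)_{σ(k)}` is strictly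
increasing in the variable `x_{σ(k)}`. -/
def SigmaMonotoneIncreasing {n : ℕ} (σ : Equiv.Perm (Fin n))
    (T : (Fin n → ℝ) → (Fin n → ℝ)) : Prop :=
  ∀ (k : Fin n) (x : Fin n → ℝ), StrictMono (fun t => T (Function.update x (σ k) t) (σ k))

/-- A function `u : ℝⁿ → ℝ` does not depend on coordinate `j`. -/
def NotDependsOn {n : ℕ} (u : (Fin n → ℝ) → ℝ) (j : Fin n) : Prop :=
  ∀ (x : Fin n → ℝ) (t : ℝ), u (Function.update x j t) = u x

lemma kr_cdf_continuous (μ : Measure ℝ) [IsProbabilityMeasure μ]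
    (h1 : μ ≪ (volume : Measure ℝ)) : Continuous (cdf μ) := by
  rw [continuous_iff_continuousAt]
  intro x
  rw [(monotone_cdf μ).continuousAt_iff_leftLim_eq_rightLim, StieltjesFunction.rightLim_eq]
  have h : (cdf μ).measure {x} = 0 := by
    rw [measure_cdf]; exact h1 (by simp)
  rw [StieltjesFunction.measure_singleton, ENNReal.ofReal_eq_zero] at h
  exact le_antisymm ((monotone_cdf μ).leftLim_le le_rfl) (by linarith)

lemma kr_cdf_strictMono (μ : Measure ℝ) [IsProbabilityMeasure μ]
    (h2 : (volume : Measure ℝ) ≪ μ) : StrictMono (cdf μ) := by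
  intro a b hab
  by_contra hcon
  have h : (cdf μ).measure (Set.Ioc a b) = 0 := by
    rw [StieltjesFunction.measure_Ioc, ENNReal.ofReal_eq_zero]
    linarith [not_lt.mp hcon]
  rw [measure_cdf] at h
  have := h2 h
  rw [Real.volume_Ioc, ENNReal.ofReal_eq_zero] at this
  linarith

lemma kr_cdf_pos (μ : Measure ℝ) [IsProbabilityMeasure μ]
    (h2 : (volume : Measure ℝ) ≪ μ) (t : ℝ) : 0 < cdf μ t :=
  (cdf_nonneg μ (t - 1)).trans_lt (kr_cdf_strictMono μ h2 (by linarith))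

lemma kr_cdf_lt_one (μ : Measure ℝ) [IsProbabilityMeasure μ]
    (h2 : (volume : Measure ℝ) ≪ μ) (t : ℝ) : cdf μ t < 1 :=
  (kr_cdf_strictMono μ h2 (show t < t + 1 by linarith)).trans_le (cdf_le_one μ (t + 1))

lemma kr_cdf_surj (μ : Measure ℝ) [IsProbabilityMeasure μ]
    (h1 : μ ≪ (volume : Measure ℝ)) (u : ℝ) (hu0 : 0 < u) (hu1 : u < 1) :
    ∃ s, cdf μ s = u := by
  obtain ⟨a, ha⟩ := ((tendsto_cdf_atBot μ).eventually (gt_mem_nhds hu0)).exists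
  obtain ⟨b, hb⟩ := ((tendsto_cdf_atTop μ).eventually (lt_mem_nhds hu1)).exists
  exact mem_range_of_exists_le_of_exists_ge (kr_cdf_continuous μ h1) ⟨a, ha.le⟩ ⟨b, hb.le⟩

/-- One-dimensional conditional rearrangement. -/
lemma kr_cond {α : Type*} [MeasurableSpace α] (ρ : Measure (α × ℝ)) [IsProbabilityMeasure ρ]
    (η : Measure ℝ) [IsProbabilityMeasure η]
    (h1 : η ≪ (volume : Measure ℝ)) (h2 : (volume : Measure ℝ) ≪ η)
    (hρ1 : ρ ≪ ρ.fst.prod η) (hρ2 : ρ.fst.prod η ≪ ρ) :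
    ∃ S : α → ℝ → ℝ, Measurable (fun q : α × ℝ => S q.1 q.2) ∧ (∀ y, StrictMono (S y)) ∧
      Measure.map (fun q : α × ℝ => (q.1, S q.1 q.2)) (ρ.fst.prod η) = ρ := by
  classical
  have hdis : ρ.fst ⊗ₘ ρ.condKernel = ρ := ρ.disintegrate ρ.condKernel
  have hc : ρ.fst ⊗ₘ (Kernel.const α η) = ρ.fst.prod η := Measure.compProd_const
  have hae : ∀ᵐ y ∂ρ.fst, ρ.condKernel y ≪ η ∧ η ≪ ρ.condKernel y := by
    have a1 : ρ.fst ⊗ₘ ρ.condKernel ≪ ρ.fst ⊗ₘ (Kernel.const α η) := by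
      rw [hdis, hc]; exact hρ1
    have a2 : ρ.fst ⊗ₘ (Kernel.const α η) ≪ ρ.fst ⊗ₘ ρ.condKernel := by
      rw [hdis, hc]; exact hρ2
    filter_upwards [a1.kernel_of_compProd, a2.kernel_of_compProd] with y b1 b2
    exact ⟨by simpa using b1, by simpa using b2⟩
  obtain ⟨G, hGsub, hGm, hG⟩ : ∃ G : Set α, (∀ y ∈ G, ρ.condKernel y ≪ η ∧ η ≪ ρ.condKernel y) ∧
      MeasurableSet G ∧ ∀ᵐ y ∂ρ.fst, y ∈ G := by
    obtain ⟨G, hn, hm, hs⟩ := hae.exists_measurable_mem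
    exact ⟨G, hs, hm, hn⟩
  have hex : ∀ y ∈ G, ∀ t, ∃ s, cdf (ρ.condKernel y) s = cdf η t := fun y hy t =>
    kr_cdf_surj _ ((hGsub y hy).1.trans h1) _ (kr_cdf_pos η h2 t) (kr_cdf_lt_one η h2 t)
  choose! S0 hS0 using hex
  let S : α → ℝ → ℝ := fun y t => if y ∈ G then S0 y t else t
  have hsm : ∀ y ∈ G, StrictMono (cdf (ρ.condKernel y)) := fun y hy =>
    kr_cdf_strictMono _ (h2.trans (hGsub y hy).2)
  have hle : ∀ y ∈ G, ∀ t c, S y t ≤ c ↔ cdf η t ≤ cdf (ρ.condKernel y) c := by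
    intro y hy t c
    simp only [S, if_pos hy]
    rw [← hS0 y hy t, (hsm y hy).le_iff_le]
  have hSm : Measurable (fun q : α × ℝ => S q.1 q.2) := by
    refine measurable_of_Iic fun c => ?_
    have hset : (fun q : α × ℝ => S q.1 q.2) ⁻¹' Set.Iic c =
        ({q | q.1 ∈ G} ∩ {q | cdf η q.2 ≤ (ρ.condKernel q.1).real (Set.Iic c)}) ∪
        ({q | q.1 ∈ G}ᶜ ∩ {q | q.2 ≤ c}) := by
      ext q
      by_cases hq : q.1 ∈ G
      · simp [hq, hle q.1 hq, cdf_eq_real]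
      · simp [hq, S]
    rw [hset]
    have hG' : MeasurableSet {q : α × ℝ | q.1 ∈ G} := measurable_fst hGm
    refine (hG'.inter (measurableSet_le ?_ ?_)).union
      (hG'.compl.inter (measurableSet_le measurable_snd measurable_const))
    · exact (monotone_cdf η).measurable.comp measurable_snd
    · exact ((ρ.condKernel.measurable_coe measurableSet_Iic).ennreal_toReal).comp measurable_fst
  refine ⟨S, hSm, ?_, ?_⟩
  · intro y t t' htt
    by_cases hy : y ∈ G
    · simp only [S, if_pos hy]
      rw [← (hsm y hy).lt_iff_lt, hS0 y hy, hS0 y hy]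
      exact kr_cdf_strictMono η h2 htt
    · simpa only [S, if_neg hy] using htt
  · have hSy : ∀ y, Measurable (S y) := fun y => hSm.comp measurable_prodMk_left
    have hmap : ∀ y ∈ G, η.map (S y) = ρ.condKernel y := by
      intro y hy
      have : IsProbabilityMeasure (η.map (S y)) :=
        Measure.isProbabilityMeasure_map (hSy y).aemeasurable
      refine Measure.ext_of_Iic _ _ fun c => ?_
      rw [Measure.map_apply (hSy y) measurableSet_Iic]
      have hh := h2.trans (hGsub y hy).2
      obtain ⟨t, ht⟩ := kr_cdf_surj η h1 (cdf (ρ.condKernel y) c) (kr_cdf_pos _ hh c)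
        (kr_cdf_lt_one _ hh c)
      have : S y ⁻¹' Set.Iic c = Set.Iic t := by
        ext t'
        simp only [Set.mem_preimage, Set.mem_Iic]
        rw [hle y hy, ← ht, (kr_cdf_strictMono η h2).le_iff_le]
      rw [this, ← ofReal_cdf, ← ofReal_cdf, ht]
    have hm2 : Measurable (fun q : α × ℝ => (q.1, S q.1 q.2)) := measurable_fst.prodMk hSm
    conv_rhs => rw [← hdis]
    ext B hB
    rw [Measure.map_apply hm2 hB, Measure.prod_apply (hm2 hB), Measure.compProd_apply hB]
    refine lintegral_congr_ae ?_
    filter_upwards [hG] with y hy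
    rw [← hmap y hy, Measure.map_apply (hSy y) (measurable_prodMk_left hB)]
    rfl

lemma kr_pi_ac : ∀ {n : ℕ} (μ ν : Fin n → Measure ℝ) [∀ i, SigmaFinite (μ i)]
    [∀ i, SigmaFinite (ν i)], (∀ i, μ i ≪ ν i) → Measure.pi μ ≪ Measure.pi ν := by
  intro n
  induction n with
  | zero =>
    intro μ ν _ _ _
    rw [Measure.pi_of_empty μ, Measure.pi_of_empty ν]
  | succ n ih =>
    intro μ ν _ _ h
    have e1 := (measurePreserving_piFinSuccAbove μ 0).symm
    have e2 := (measurePreserving_piFinSuccAbove ν 0).symm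
    rw [← e1.map_eq, ← e2.map_eq]
    exact ((h 0).prod (ih _ _ fun i => h _)).map (MeasurableEquiv.measurable _)

/-- Independence of disjoint blocks under a product measure. -/
lemma kr_indep {n : ℕ} (η : Fin n → Measure ℝ) [∀ i, IsProbabilityMeasure (η i)]
    (s t : Finset (Fin n)) (hst : Disjoint s t) :
    IndepFun (fun (x : Fin n → ℝ) (i : s) => x i) (fun (x : Fin n → ℝ) (i : t) => x i)
      (Measure.pi η) :=
  (iIndepFun_pi (μ := η) (X := fun _ => id) (fun _ => aemeasurable_id)).indepFun_finset s t hst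
    (fun i => measurable_pi_apply i)

/-- A measurable map whose `s`-components depend only on the `s`-coordinates factors. -/
lemma kr_factor {n : ℕ} (s : Finset (Fin n)) (T : (Fin n → ℝ) → (Fin n → ℝ)) (hT : Measurable T)
    (hdep : ∀ k ∈ s, ∀ x y : Fin n → ℝ, (∀ j ∈ s, x j = y j) → T x k = T y k) :
    ∃ φ : (s → ℝ) → (s → ℝ), Measurable φ ∧ ∀ x : Fin n → ℝ,
      (fun i : s => T x i) = φ (fun i : s => x i) := by
  classical
  let E : (s → ℝ) → (Fin n → ℝ) := fun y i => if h : i ∈ s then y ⟨i, h⟩ else 0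
  have hE : Measurable E := by
    refine measurable_pi_lambda _ fun i => ?_
    by_cases h : i ∈ s
    · simp only [E, dif_pos h]; exact measurable_pi_apply _
    · simp only [E, dif_neg h]; exact measurable_const
  refine ⟨fun y i => T (E y) i, ?_, ?_⟩
  · exact measurable_pi_lambda _ fun i => (measurable_pi_apply _).comp (hT.comp hE)
  · intro x
    ext i
    refine hdep i i.2 _ _ fun j hj => ?_
    simp [E, hj]

lemma kr_main {n : ℕ} (η : Fin n → Measure ℝ) [∀ i, IsProbabilityMeasure (η i)]
    (h1 : ∀ i, η i ≪ (volume : Measure ℝ)) (h2 : ∀ i, (volume : Measure ℝ) ≪ η i)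
    (π : Measure (Fin n → ℝ)) [IsProbabilityMeasure π]
    (hp1 : π ≪ Measure.pi η) (hp2 : Measure.pi η ≪ π) (r : Fin n → Fin n)
    (s : Finset (Fin n)) :
    ∃ T : (Fin n → ℝ) → (Fin n → ℝ), Measurable T ∧
      (∀ k ∈ s, ∀ x y : Fin n → ℝ, (∀ j ∈ s, r j ≤ r k → x j = y j) → T x k = T y k) ∧
      (∀ k ∈ s, ∀ x : Fin n → ℝ, StrictMono (fun t => T (Function.update x k t) k)) ∧
      Measure.map (fun x (i : s) => T x i) (Measure.pi η) =
        Measure.map (fun (x : Fin n → ℝ) (i : s) => x i) π := by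
  classical
  induction s using Finset.induction_on_max_value r with
  | empty =>
    refine ⟨id, measurable_id, by simp, by simp, ?_⟩
    have : ∀ m : Measure ((∅ : Finset (Fin n)) → ℝ), IsProbabilityMeasure m →
        m = Measure.dirac (fun i => 0) := by
      intro m hm
      ext B hB
      rcases Set.eq_empty_or_nonempty B with hB0 | hB0
      · simp [hB0]
      · rw [Subsingleton.eq_univ_of_nonempty hB0]; simp
    rw [this _ (Measure.isProbabilityMeasure_map (measurable_pi_lambda _ fun i => measurable_pi_apply _).aemeasurable),
      this _ (Measure.isProbabilityMeasure_map (measurable_pi_lambda _ fun i => measurable_pi_apply _).aemeasurable)]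
  | insert a s ha hmax ih =>
    obtain ⟨T, hTm, hTd, hTs, hTp⟩ := ih
    -- joint law of the `s`-block and coordinate `a` under `π`
    let R : (Fin n → ℝ) → (s → ℝ) := fun x i => x i
    have hR : Measurable R := by fun_prop
    let h : (Fin n → ℝ) → (s → ℝ) × ℝ := fun x => (R x, x a)
    have hh : Measurable h := hR.prodMk (measurable_pi_apply a)
    let ρ := Measure.map h π
    have : IsProbabilityMeasure ρ := Measure.isProbabilityMeasure_map hh.aemeasurable
    have hfst : ρ.fst = Measure.map R π := by
      simp only [ρ, Measure.fst]
      rw [Measure.map_map measurable_fst hh]; rfl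
    have hind : IndepFun R (fun x => x a) (Measure.pi η) :=
      (kr_indep η s {a} (by simpa using ha)).comp measurable_id
        (measurable_pi_apply (⟨a, by simp⟩ : ({a} : Finset (Fin n))))
    have hηa : Measure.map (fun x : Fin n → ℝ => x a) (Measure.pi η) = η a :=
      (measurePreserving_eval η a).map_eq
    have hprod : Measure.map h (Measure.pi η) = (Measure.map R (Measure.pi η)).prod (η a) := by
      rw [← hηa]
      exact hind.map_prod_eq_prod_map_map hR.aemeasurable (measurable_pi_apply a).aemeasurable
    have hpR : IsProbabilityMeasure (Measure.map R (Measure.pi η)) :=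
      Measure.isProbabilityMeasure_map hR.aemeasurable
    have hpR' : IsProbabilityMeasure (Measure.map R π) :=
      Measure.isProbabilityMeasure_map hR.aemeasurable
    have hρ1 : ρ ≪ ρ.fst.prod (η a) := by
      rw [hfst]
      have := hp1.map hh
      rw [hprod] at this
      exact this.trans ((hp2.map hR).prod Measure.AbsolutelyContinuous.rfl)
    have hρ2 : ρ.fst.prod (η a) ≪ ρ := by
      rw [hfst]
      have := hp2.map hh
      rw [hprod] at this
      exact ((hp1.map hR).prod Measure.AbsolutelyContinuous.rfl).trans this
    obtain ⟨S, hSm, hSs, hSp⟩ := kr_cond ρ (η a) (h1 a) (h2 a) hρ1 hρ2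
    have hRT : Measurable (fun x => R (T x)) := hR.comp hTm
    have hne : ∀ k ∈ s, k ≠ a := fun k hk hka => ha (hka ▸ hk)
    let T' : (Fin n → ℝ) → (Fin n → ℝ) := fun x => Function.update (T x) a (S (R (T x)) (x a))
    have hT'a : ∀ x, T' x a = S (R (T x)) (x a) := fun x => by simp [T']
    have hT'k : ∀ k ≠ a, ∀ x, T' x k = T x k := fun k hk x => by simp [T', hk]
    have hRdep : ∀ x y : Fin n → ℝ, (∀ j ∈ s, x j = y j) → R (T x) = R (T y) := by
      intro x y hxy
      ext i
      exact hTd i i.2 x y fun j hj _ => hxy j hj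
    have hSx : Measurable (fun x => S (R (T x)) (x a)) :=
      hSm.comp (hRT.prodMk (measurable_pi_apply a))
    have hT'm : Measurable T' := by
      refine measurable_pi_lambda _ fun k => ?_
      by_cases hk : k = a
      · subst hk; simpa only [hT'a] using hSx
      · simp only [hT'k k hk]; exact (measurable_pi_apply k).comp hTm
    refine ⟨T', hT'm, ?_, ?_, ?_⟩
    · intro k hk x y hxy
      rcases Finset.mem_insert.1 hk with rfl | hks
      · rw [hT'a, hT'a, hRdep x y fun j hj => hxy j (Finset.mem_insert_of_mem hj) (hmax j hj),
          hxy k hk le_rfl]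
      · rw [hT'k k (hne k hks), hT'k k (hne k hks)]
        exact hTd k hks x y fun j hj hjk => hxy j (Finset.mem_insert_of_mem hj) hjk
    · intro k hk x
      rcases Finset.mem_insert.1 hk with rfl | hks
      · intro t t' htt
        simp only [hT'a, Function.update_self]
        rw [hRdep (Function.update x k t') (Function.update x k t) fun j hj => by
          simp [hne j hj]]
        exact hSs _ htt
      · simp only [hT'k k (hne k hks)]
        exact hTs k hks x
    · let g : (s → ℝ) × ℝ → (↥(insert a s : Finset (Fin n)) → ℝ) := fun q i =>
        if hi : (i : Fin n) ∈ s then q.1 ⟨i, hi⟩ else q.2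
      have hg : Measurable g := by
        refine measurable_pi_lambda _ fun i => ?_
        by_cases hi : (i : Fin n) ∈ s
        · simp only [g, dif_pos hi]; exact (measurable_pi_apply _).comp measurable_fst
        · simp only [g, dif_neg hi]; exact measurable_snd
      have hgh : ∀ x : Fin n → ℝ, g (R x, x a) = fun i : ↥(insert a s : Finset (Fin n)) => x i := by
        intro x
        ext i
        by_cases hi : (i : Fin n) ∈ s
        · simp [g, hi, R]
        · have : (i : Fin n) = a := by
            rcases Finset.mem_insert.1 i.2 with h | h
            · exact h
            · exact absurd h hi
          simp [g, hi, this, ha]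
      obtain ⟨φ, hφ, hφx⟩ := kr_factor s T hTm fun k hk x y hxy =>
        hTd k hk x y fun j hj _ => hxy j hj
      have hind2 : IndepFun (fun x => R (T x)) (fun x => x a) (Measure.pi η) := by
        have := hind.comp hφ measurable_id
        have he : (fun x => R (T x)) = φ ∘ R := by
          funext x; exact hφx x
        rw [he]; exact this
      have hj : Measure.map (fun x => (R (T x), x a)) (Measure.pi η) = ρ.fst.prod (η a) := by
        rw [hind2.map_prod_eq_prod_map_map hRT.aemeasurable (measurable_pi_apply a).aemeasurable,
          hηa, hfst]
        congr 1
      have hRT' : ∀ x, R (T' x) = R (T x) := by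
        intro x; ext i; exact hT'k i (hne i i.2) x
      have lhs : (fun x (i : (insert a s : Finset (Fin n))) => T' x i) =
          g ∘ (fun q : (s → ℝ) × ℝ => (q.1, S q.1 q.2)) ∘ (fun x => (R (T x), x a)) := by
        funext x
        simp only [Function.comp]
        rw [← hT'a, ← hRT', hgh]
      have rhs : (fun (x : Fin n → ℝ) (i : (insert a s : Finset (Fin n))) => x i) = g ∘ h := by
        funext x
        exact (hgh x).symm
      have hm2 : Measurable (fun q : (s → ℝ) × ℝ => (q.1, S q.1 q.2)) := measurable_fst.prodMk hSm
      have hm3 : Measurable (fun x : Fin n → ℝ => (R (T x), x a)) :=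
        hRT.prodMk (measurable_pi_apply a)
      rw [lhs, rhs, ← Measure.map_map hg (hm2.comp hm3), ← Measure.map_map hm2 hm3, hj, hSp,
        ← Measure.map_map hg hh]

/-- **Low-dimensional generalized Knothe–Rosenblatt rearrangements.**
Let `η` be a fully supported absolutely continuous product probability measure on `ℝⁿ` and `π` a
fully supported absolutely continuous probability measure such that, under `π`, the coordinates
in `A` are independent of the remaining coordinates and have the same joint law as under `η`.
Then for every permutation `σ` there is a `σ`-triangular monotone increasing map `T` pushing `η`
forward to `π` that is low-dimensional with respect to `A`: `T(x)_k = x_k` for `k ∈ A`, and no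
component with index outside `A` depends on a coordinate in `A`. -/
theorem exists_lowdimensional_generalized_KR
    (n : ℕ) (hn : 0 < n)
    (ηk : Fin n → Measure ℝ) (e : Fin n → ℝ → ℝ)
    (hηprob : ∀ k, IsProbabilityMeasure (ηk k))
    (hemeas : ∀ k, Measurable (e k))
    (hηd : ∀ k, ηk k = (volume : Measure ℝ).withDensity (fun t => ENNReal.ofReal (e k t)))
    (hηpos : ∀ k, ∀ᵐ t ∂(volume : Measure ℝ), 0 < e k t)
    (π : Measure (Fin n → ℝ)) [IsProbabilityMeasure π]
    (p : (Fin n → ℝ) → ℝ) (hpmeas : Measurable p)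
    (hπd : π = (volume : Measure (Fin n → ℝ)).withDensity (fun x => ENNReal.ofReal (p x)))
    (hπpos : ∀ᵐ x ∂(volume : Measure (Fin n → ℝ)), 0 < p x)
    (A : Set (Fin n))
    (hindep : IndepFun A.restrict Aᶜ.restrict π)
    (hmarg : Measure.map A.restrict π = Measure.map A.restrict (Measure.pi ηk)) :
    ∀ σ : Equiv.Perm (Fin n),
      ∃ T : (Fin n → ℝ) → (Fin n → ℝ),
        SigmaTriangular σ T ∧ SigmaMonotoneIncreasing σ T ∧
        Measure.map T (Measure.pi ηk) = π ∧
        (∀ k ∈ A, ∀ x, T x k = x k) ∧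
        (∀ k ∉ A, ∀ j ∈ A, NotDependsOn (fun x => T x k) j) := by
  classical
  intro σ
  have h1 : ∀ i, ηk i ≪ (volume : Measure ℝ) := fun i => by
    rw [hηd i]; exact withDensity_absolutelyContinuous _ _
  have h2 : ∀ i, (volume : Measure ℝ) ≪ ηk i := fun i => by
    rw [hηd i]
    refine withDensity_absolutelyContinuous' (hemeas i).ennreal_ofReal.aemeasurable ?_
    filter_upwards [hηpos i] with t ht
    simpa using ht
  have hp1 : π ≪ Measure.pi ηk := by
    have : π ≪ volume := by rw [hπd]; exact withDensity_absolutelyContinuous _ _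
    exact this.trans (kr_pi_ac (fun _ => volume) ηk h2)
  have hp2 : Measure.pi ηk ≪ π := by
    have : volume ≪ π := by
      rw [hπd]
      refine withDensity_absolutelyContinuous' hpmeas.ennreal_ofReal.aemeasurable ?_
      filter_upwards [hπpos] with t ht
      simpa using ht
    exact (kr_pi_ac ηk (fun _ => volume) h1).trans this
  let s : Finset (Fin n) := Finset.univ.filter (fun i => i ∉ A)
  let c : Finset (Fin n) := Finset.univ.filter (fun i => i ∈ A)
  have hs : ∀ i, i ∈ s ↔ i ∉ A := fun i => by simp [s]
  have hc : ∀ i, i ∈ c ↔ i ∈ A := fun i => by simp [c]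
  obtain ⟨T0, hTm, hTd, hTs, hTp⟩ := kr_main ηk h1 h2 π hp1 hp2 σ.symm s
  let T : (Fin n → ℝ) → (Fin n → ℝ) := fun x k => if k ∈ A then x k else T0 x k
  have hTA : ∀ k ∈ A, ∀ x, T x k = x k := fun k hk x => by simp [T, hk]
  have hTB : ∀ k ∉ A, ∀ x, T x k = T0 x k := fun k hk x => by simp [T, hk]
  have hTmeas : Measurable T := by
    refine measurable_pi_lambda _ fun k => ?_
    by_cases hk : k ∈ A
    · simp only [hTA k hk]; exact measurable_pi_apply k
    · simp only [hTB k hk]; exact (measurable_pi_apply k).comp hTm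
  refine ⟨T, ?_, ?_, ?_, hTA, ?_⟩
  · intro k x y hxy
    by_cases hk : σ k ∈ A
    · rw [hTA _ hk, hTA _ hk]; exact hxy k le_rfl
    · rw [hTB _ hk, hTB _ hk]
      refine hTd _ ((hs _).2 hk) x y fun j _ hjk => ?_
      have := hxy (σ.symm j) (by simpa using hjk)
      simpa using this
  · intro k x
    by_cases hk : σ k ∈ A
    · simp only [hTA _ hk, Function.update_self]; exact strictMono_id
    · simp only [hTB _ hk]
      exact hTs _ ((hs _).2 hk) x
  · let Rs : (Fin n → ℝ) → (s → ℝ) := fun x i => x i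
    let Rc : (Fin n → ℝ) → (c → ℝ) := fun x i => x i
    have hRs : Measurable Rs := by fun_prop
    have hRc : Measurable Rc := by fun_prop
    have hq : Measurable (fun (y : A → ℝ) (i : c) => y ⟨i, (hc i).1 i.2⟩) := by fun_prop
    have hq' : Measurable (fun (y : (Aᶜ : Set (Fin n)) → ℝ) (i : s) => y ⟨i, (hs i).1 i.2⟩) := by
      fun_prop
    have hindπ : IndepFun Rc Rs π := hindep.comp hq hq'
    have hAm : Measurable (A.restrict : (Fin n → ℝ) → (A → ℝ)) := measurable_pi_lambda _ fun i => measurable_pi_apply _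
    have hmargc : Measure.map Rc π = Measure.map Rc (Measure.pi ηk) := by
      have := congrArg (Measure.map (fun (y : A → ℝ) (i : c) => y ⟨i, (hc i).1 i.2⟩)) hmarg
      rw [Measure.map_map hq hAm, Measure.map_map hq hAm] at this
      exact this
    obtain ⟨φ, hφ, hφx⟩ := kr_factor s T0 hTm fun k hk x y hxy =>
      hTd k hk x y fun j hj _ => hxy j hj
    have hindη : IndepFun Rc (fun x => Rs (T0 x)) (Measure.pi ηk) := by
      have hdis : Disjoint c s := by
        rw [Finset.disjoint_left]
        intro i hi hi'
        exact (hs i).1 hi' ((hc i).1 hi)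
      have := (kr_indep ηk c s hdis).comp measurable_id hφ
      have he : (fun x => Rs (T0 x)) = φ ∘ Rs := by
        funext x; exact hφx x
      rw [he]; exact this
    let g : (c → ℝ) × (s → ℝ) → (Fin n → ℝ) := fun q i =>
      if hi : i ∈ A then q.1 ⟨i, (hc i).2 hi⟩ else q.2 ⟨i, (hs i).2 hi⟩
    have hg : Measurable g := by
      refine measurable_pi_lambda _ fun i => ?_
      by_cases hi : i ∈ A
      · simp only [g, dif_pos hi]; exact (measurable_pi_apply _).comp measurable_fst
      · simp only [g, dif_neg hi]; exact (measurable_pi_apply _).comp measurable_snd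
    have hRsT : Measurable (fun x => Rs (T0 x)) := hRs.comp hTm
    have lhs : T = g ∘ (fun x => (Rc x, Rs (T0 x))) := by
      funext x i
      by_cases hi : i ∈ A
      · simp [T, g, hi, Rc]
      · simp [T, g, hi, Rs]
    have rhs : (id : (Fin n → ℝ) → (Fin n → ℝ)) = g ∘ (fun x => (Rc x, Rs x)) := by
      funext x i
      by_cases hi : i ∈ A
      · simp [g, hi, Rc]
      · simp [g, hi, Rs]
    conv_rhs => rw [← Measure.map_id (μ := π), rhs]
    rw [lhs, ← Measure.map_map hg (hRc.prodMk hRsT), ← Measure.map_map hg (hRc.prodMk hRs),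
      hindη.map_prod_eq_prod_map_map hRc.aemeasurable hRsT.aemeasurable,
      hindπ.map_prod_eq_prod_map_map hRc.aemeasurable hRs.aemeasurable, hmargc]
    congr 2
  · intro k hk j hj x t
    simp only [hTB k hk]
    refine hTd k ((hs k).2 hk) _ _ fun i hi _ => ?_
    have : i ≠ j := fun h => (hs i).1 hi (h ▸ hj)
    simp [this]
end
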